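/- arXiv:2501.02854 — 2 statements merged into one kernel-verified Lean document; each statement's English description precedes it below -/
import Mathlib

section
/- Assume hypotheses (Ha) and (G). Then there exists a constant λ_c < 0 (depending only on a) such that for every λ < λ_c the problem (P_λ) possesses at least 2^n − 1 pairwise distinct positive solutions. -/
open Set

/-- `u` is a nonnegative solution of problem (P_λ):
`u ∈ C²([0,L])`, `u ≥ 0`, `-u'' = λ u + a u^p` on `(0,L)`, `u(0) = u(L) = 0`. -/
def IsNonnegSol (L p lam : ℝ) (a u : ℝ → ℝ) : Prop :=
  ∃ u' u'' : ℝ → ℝ,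
    (∀ x ∈ Set.Icc (0:ℝ) L, HasDerivWithinAt u (u' x) (Set.Icc (0:ℝ) L) x) ∧
    (∀ x ∈ Set.Icc (0:ℝ) L, HasDerivWithinAt u' (u'' x) (Set.Icc (0:ℝ) L) x) ∧
    ContinuousOn u'' (Set.Icc (0:ℝ) L) ∧
    (∀ x ∈ Set.Icc (0:ℝ) L, 0 ≤ u x) ∧
    (∀ x ∈ Set.Ioo (0:ℝ) L, -u'' x = lam * u x + a x * u x ^ p) ∧
    u 0 = 0 ∧ u L = 0

open Filter Topology

/-- `w` and `v = w'` solve `w'' = μ² (w - A f(w))` on `[0, T]`. -/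
def IsTrajectory (T μ : ℝ) (A f w v : ℝ → ℝ) : Prop :=
  ∀ x ∈ Icc (0 : ℝ) T,
    HasDerivAt w (v x) x ∧ HasDerivAt v (μ ^ 2 * (w x - A x * f (w x))) x

lemma antitoneOn_Icc_of_hasDerivAt {g g' : ℝ → ℝ} {c d : ℝ}
    (hg : ∀ x ∈ Icc c d, HasDerivAt g (g' x) x) (hg' : ∀ x ∈ Icc c d, g' x ≤ 0) :
    AntitoneOn g (Icc c d) :=
  antitoneOn_of_hasDerivWithinAt_nonpos (convex_Icc c d)
    (fun x hx ↦ (hg x hx).continuousAt.continuousWithinAt)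
    (fun x hx ↦ (hg x (interior_subset hx)).hasDerivWithinAt)
    (fun x hx ↦ hg' x (interior_subset hx))

lemma monotoneOn_Icc_of_hasDerivAt {g g' : ℝ → ℝ} {c d : ℝ}
    (hg : ∀ x ∈ Icc c d, HasDerivAt g (g' x) x) (hg' : ∀ x ∈ Icc c d, 0 ≤ g' x) :
    MonotoneOn g (Icc c d) :=
  monotoneOn_of_hasDerivWithinAt_nonneg (convex_Icc c d)
    (fun x hx ↦ (hg x hx).continuousAt.continuousWithinAt)
    (fun x hx ↦ (hg x (interior_subset hx)).hasDerivWithinAt)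
    (fun x hx ↦ hg' x (interior_subset hx))

/-- A two-sided Gronwall estimate for planar systems of at most linear growth. -/
lemma sq_add_sq_le_of_linear_growth {T K : ℝ} {w v P Q : ℝ → ℝ} (hK : 0 ≤ K)
    (hw : ∀ x ∈ Icc 0 T, HasDerivAt w (P x) x) (hv : ∀ x ∈ Icc 0 T, HasDerivAt v (Q x) x)
    (hP : ∀ x ∈ Icc 0 T, |P x| ≤ |v x|) (hQ : ∀ x ∈ Icc 0 T, |Q x| ≤ K * |w x|)
    {x y : ℝ} (hx : x ∈ Icc 0 T) (hy : y ∈ Icc 0 T) :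
    w y ^ 2 + v y ^ 2 ≤ Real.exp ((1 + K) * T) * (w x ^ 2 + v x ^ 2) := by
  have key : ∀ z ∈ Icc 0 T,
      |2 * w z * P z + 2 * v z * Q z| ≤ (1 + K) * (w z ^ 2 + v z ^ 2) := by
    intro z hz
    have h1 : |w z * P z| ≤ |w z| * |v z| := by
      rw [abs_mul]; exact mul_le_mul_of_nonneg_left (hP z hz) (abs_nonneg _)
    have h2 : |v z * Q z| ≤ |v z| * (K * |w z|) := by
      rw [abs_mul]; exact mul_le_mul_of_nonneg_left (hQ z hz) (abs_nonneg _)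
    have h3 : 2 * (|w z| * |v z|) ≤ w z ^ 2 + v z ^ 2 := by
      rw [← sq_abs (w z), ← sq_abs (v z)]; nlinarith [sq_nonneg (|w z| - |v z|)]
    have h4 : |2 * w z * P z + 2 * v z * Q z| ≤ 2 * |w z * P z| + 2 * |v z * Q z| := by
      have := abs_add_le (2 * (w z * P z)) (2 * (v z * Q z))
      rw [abs_mul, abs_mul 2 (v z * Q z), abs_two] at this
      calc _ = |2 * (w z * P z) + 2 * (v z * Q z)| := by ring_nf
        _ ≤ _ := this
    nlinarith [mul_le_mul_of_nonneg_left h3 (by linarith : 0 ≤ 1 + K)]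
  have hN : ∀ z ∈ Icc 0 T, HasDerivAt (fun t ↦ w t ^ 2 + v t ^ 2)
      (2 * w z * P z + 2 * v z * Q z) z := by
    intro z hz
    exact (((hw z hz).pow 2).add ((hv z hz).pow 2)).congr_deriv (by simp)
  have hE : ∀ (c z : ℝ), HasDerivAt (fun t ↦ Real.exp (c * t)) (Real.exp (c * z) * c) z := by
    intro c z
    simpa using ((hasDerivAt_id z).const_mul c).exp
  have hpos : 0 ≤ w x ^ 2 + v x ^ 2 := by positivity
  rcases le_total x y with hxy | hxy
  · have hanti : AntitoneOn (fun t ↦ (w t ^ 2 + v t ^ 2) * Real.exp (-(1 + K) * t)) (Icc 0 T) := by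
      refine antitoneOn_Icc_of_hasDerivAt (fun z hz ↦ (hN z hz).mul (hE _ z)) fun z hz ↦ ?_
      have h1 := (abs_le.1 (key z hz)).2
      have h2 := Real.exp_pos (-(1 + K) * z)
      nlinarith
    have h := hanti hx hy hxy
    simp only at h
    have h3 : w y ^ 2 + v y ^ 2 ≤ (w x ^ 2 + v x ^ 2) * Real.exp ((1 + K) * (y - x)) := by
      have h4 := mul_le_mul_of_nonneg_right h (Real.exp_pos ((1 + K) * y)).le
      rw [mul_assoc, mul_assoc, ← Real.exp_add, ← Real.exp_add] at h4
      ring_nf at h4 ⊢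
      simpa using h4
    rw [mul_comm]
    refine h3.trans (mul_le_mul_of_nonneg_left (Real.exp_le_exp.2 ?_) hpos)
    nlinarith [hx.1, hy.2]
  · have hmono : MonotoneOn (fun t ↦ (w t ^ 2 + v t ^ 2) * Real.exp ((1 + K) * t)) (Icc 0 T) := by
      refine monotoneOn_Icc_of_hasDerivAt (fun z hz ↦ (hN z hz).mul (hE _ z)) fun z hz ↦ ?_
      have h1 := (abs_le.1 (key z hz)).1
      have h2 := Real.exp_pos ((1 + K) * z)
      nlinarith
    have h := hmono hy hx hxy
    simp only at h
    have h3 : w y ^ 2 + v y ^ 2 ≤ (w x ^ 2 + v x ^ 2) * Real.exp ((1 + K) * (x - y)) := by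
      have h4 := mul_le_mul_of_nonneg_right h (Real.exp_pos (-(1 + K) * y)).le
      rw [mul_assoc, mul_assoc, ← Real.exp_add, ← Real.exp_add] at h4
      ring_nf at h4 ⊢
      simpa using h4
    rw [mul_comm]
    refine h3.trans (mul_le_mul_of_nonneg_left (Real.exp_le_exp.2 ?_) hpos)
    nlinarith [hx.2, hy.1]

/-- Second order necessary condition at an interior local maximum. -/
lemma second_deriv_nonpos_of_isLocalMax {w v : ℝ → ℝ} {y c : ℝ} (hmax : IsLocalMax w y)
    (hw : ∀ᶠ x in 𝓝 y, HasDerivAt w (v x) x) (hv : HasDerivAt v c y) : c ≤ 0 := by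
  by_contra! hc
  have hd : deriv w =ᶠ[𝓝 y] v := hw.mono fun x hx ↦ hx.deriv
  have h0 : deriv w y = 0 := hmax.deriv_eq_zero
  have h2 : deriv (deriv w) y = c := by rw [hd.deriv_eq, hv.deriv]
  have hmin := isLocalMin_of_deriv_deriv_pos (h2 ▸ hc) h0 hw.self_of_nhds.continuousAt
  have hconst : w =ᶠ[𝓝 y] fun _ ↦ w y := by
    filter_upwards [hmax, hmin] with x h1 h2 using le_antisymm h1 h2
  have hd0 : deriv w =ᶠ[𝓝 y] fun _ ↦ 0 := by
    filter_upwards [hconst.eventuallyEq_nhds] with x hx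
    rw [hx.deriv_eq, deriv_const]
  rw [hd0.deriv_eq, deriv_const] at h2
  exact hc.ne h2

lemma deriv_nonneg_of_le_right_endpoint {w : ℝ → ℝ} {c d m : ℝ} (hcd : c < d)
    (hw : HasDerivAt w m d) (hle : ∀ x ∈ Icc c d, w x ≤ w d) : 0 ≤ m := by
  have h := hasDerivWithinAt_iff_tendsto_slope' (s := Iio d) (by simp) |>.1 hw.hasDerivWithinAt
  refine ge_of_tendsto h ?_
  filter_upwards [Ioo_mem_nhdsLT hcd] with x hx
  rw [slope_def_field]
  exact div_nonneg_of_nonpos (by linarith [hle x ⟨hx.1.le, hx.2.le⟩]) (by linarith [hx.2])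

lemma deriv_nonpos_of_le_left_endpoint {w : ℝ → ℝ} {c d m : ℝ} (hcd : c < d)
    (hw : HasDerivAt w m c) (hle : ∀ x ∈ Icc c d, w x ≤ w c) : m ≤ 0 := by
  have h := hasDerivWithinAt_iff_tendsto_slope' (s := Ioi c) (by simp) |>.1 hw.hasDerivWithinAt
  refine le_of_tendsto h ?_
  filter_upwards [Ioo_mem_nhdsGT hcd] with x hx
  rw [slope_def_field]
  exact div_nonpos_of_nonpos_of_nonneg (by linarith [hle x ⟨hx.1.le, hx.2.le⟩]) (by linarith [hx.1])

namespace IsTrajectory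

variable {T μ : ℝ} {A f w v : ℝ → ℝ}

lemma continuousOn (h : IsTrajectory T μ A f w v) : ContinuousOn w (Icc 0 T) :=
  fun x hx ↦ (h x hx).1.continuousAt.continuousWithinAt

lemma reflect (h : IsTrajectory T μ A f w v) :
    IsTrajectory T μ (fun x ↦ A (T - x)) f (fun x ↦ w (T - x)) (fun x ↦ -v (T - x)) := by
  intro x hx
  have hx' : T - x ∈ Icc 0 T := ⟨by linarith [hx.2], by linarith [hx.1]⟩
  have hs : HasDerivAt (fun x : ℝ ↦ T - x) (-1) x := by
    simpa using (hasDerivAt_id x).const_sub T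
  exact ⟨((h _ hx').1.comp x hs).congr_deriv (by ring),
    ((h _ hx').2.comp x hs).neg.congr_deriv (by ring)⟩

lemma eventually_hasDerivAt (h : IsTrajectory T μ A f w v) {y : ℝ} (hy : y ∈ Ioo 0 T) :
    ∀ᶠ x in 𝓝 y, HasDerivAt w (v x) x := by
  filter_upwards [Ioo_mem_nhds hy.1 hy.2] with x hx
  exact (h x ⟨hx.1.le, hx.2.le⟩).1

lemma le_of_isLocalMax (h : IsTrajectory T μ A f w v) (hμ : 0 < μ) {y : ℝ} (hy : y ∈ Ioo 0 T)
    (hmax : IsLocalMax w y) : w y ≤ A y * f (w y) := by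
  have h1 := second_deriv_nonpos_of_isLocalMax hmax (h.eventually_hasDerivAt hy)
    (h y ⟨hy.1.le, hy.2.le⟩).2
  have : 0 < μ ^ 2 := by positivity
  by_contra! hc
  nlinarith

lemma ge_of_isLocalMin (h : IsTrajectory T μ A f w v) (hμ : 0 < μ) {y : ℝ} (hy : y ∈ Ioo 0 T)
    (hmin : IsLocalMin w y) : A y * f (w y) ≤ w y := by
  have h1 := second_deriv_nonpos_of_isLocalMax hmin.neg
    ((h.eventually_hasDerivAt hy).mono fun x hx ↦ hx.neg) (h y ⟨hy.1.le, hy.2.le⟩).2.neg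
  have : 0 < μ ^ 2 := by positivity
  by_contra! hc
  nlinarith

/-- A trajectory issuing from `0` that is nonnegative at `x` is nonnegative before `x`. -/
lemma nonneg_of_nonneg (h : IsTrajectory T μ A f w v) (hμ : 0 < μ)
    (hf : ∀ u ≤ 0, f u = 0) (h0 : w 0 = 0) {x : ℝ} (hx : x ∈ Icc 0 T) (hwx : 0 ≤ w x) :
    ∀ y ∈ Icc 0 x, 0 ≤ w y := by
  obtain ⟨z, hz, hzmin⟩ := isCompact_Icc.exists_isMinOn (nonempty_Icc.2 hx.1)
    (h.continuousOn.mono (Icc_subset_Icc_right hx.2))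
  intro y hy
  refine le_trans ?_ (hzmin hy)
  by_contra! hneg
  have hz0 : z ≠ 0 := by rintro rfl; linarith
  have hzx : z ≠ x := by rintro rfl; linarith
  have hz1 : 0 < z := lt_of_le_of_ne hz.1 hz0.symm
  have hz2 : z < x := lt_of_le_of_ne hz.2 hzx
  have := h.ge_of_isLocalMin hμ ⟨hz1, hz2.trans_le hx.2⟩ (hzmin.isLocalMin (Icc_mem_nhds hz1 hz2))
  rw [hf _ hneg.le] at this
  linarith

lemma sq_add_sq_le (h : IsTrajectory T μ A f w v) {K : ℝ} (hK : 0 ≤ K)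
    (hlin : ∀ x ∈ Icc 0 T, ∀ u, |μ ^ 2 * (u - A x * f u)| ≤ K * |u|) {x y : ℝ}
    (hx : x ∈ Icc 0 T) (hy : y ∈ Icc 0 T) :
    w y ^ 2 + v y ^ 2 ≤ Real.exp ((1 + K) * T) * (w x ^ 2 + v x ^ 2) :=
  sq_add_sq_le_of_linear_growth hK (fun x hx ↦ (h x hx).1) (fun x hx ↦ (h x hx).2)
    (fun _ _ ↦ le_rfl) (fun x hx ↦ hlin x hx _) hx hy

lemma eq_zero_of_eq_zero (h : IsTrajectory T μ A f w v) {K : ℝ} (hK : 0 ≤ K)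
    (hlin : ∀ x ∈ Icc 0 T, ∀ u, |μ ^ 2 * (u - A x * f u)| ≤ K * |u|) {x y : ℝ}
    (hx : x ∈ Icc 0 T) (hy : y ∈ Icc 0 T) (hw : w x = 0) (hv : v x = 0) : w y = 0 := by
  have := h.sq_add_sq_le hK hlin hx hy
  rw [hw, hv] at this
  have h2 : w y ^ 2 ≤ 0 := by nlinarith [sq_nonneg (v y)]
  exact pow_eq_zero_iff two_ne_zero |>.1 (le_antisymm h2 (sq_nonneg _))

/-- A trajectory issuing from `0` that vanishes at `x > 0` is nonpositive after `x`. -/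
lemma nonpos_of_eq_zero (h : IsTrajectory T μ A f w v) (hμ : 0 < μ) {K : ℝ} (hK : 0 ≤ K)
    (hlin : ∀ x ∈ Icc 0 T, ∀ u, |μ ^ 2 * (u - A x * f u)| ≤ K * |u|)
    (hf : ∀ u ≤ 0, f u = 0) (h0 : w 0 = 0) {x : ℝ} (hx0 : 0 < x) (hwx : w x = 0) :
    ∀ y ∈ Icc x T, w y ≤ 0 := by
  intro y hy
  by_contra! hpos
  have hyT : y ∈ Icc 0 T := ⟨hx0.le.trans hy.1, hy.2⟩
  have hnn := h.nonneg_of_nonneg hμ hf h0 hyT hpos.le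
  have hxy : x < y := lt_of_le_of_ne hy.1 (by rintro rfl; linarith)
  have hxT : x ∈ Icc 0 T := ⟨hx0.le, hxy.le.trans hy.2⟩
  have hmin : IsLocalMin w x := by
    filter_upwards [Icc_mem_nhds hx0 hxy] with z hz
    rw [hwx]; exact hnn z hz
  have hv : v x = 0 := hmin.hasDerivAt_eq_zero (h x hxT).1
  have := h.eq_zero_of_eq_zero hK hlin hxT hyT hwx hv
  linarith

/-- Growth where the weight is nonpositive. -/
lemma cosh_le (h : IsTrajectory T μ A f w v) (hμ : 0 < μ) (hf : ∀ u, 0 ≤ f u) {c d : ℝ}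
    (hc : 0 ≤ c) (hd : d ≤ T) (hA : ∀ x ∈ Icc c d, A x ≤ 0) (hv : 0 ≤ v c) :
    ∀ x ∈ Icc c d, w c * Real.cosh (μ * (x - c)) ≤ w x := by
  have hsub : Icc c d ⊆ Icc 0 T := Icc_subset_Icc hc hd
  have hs : ∀ x : ℝ, HasDerivAt (fun x ↦ μ * (x - c)) μ x := fun x ↦ by
    simpa using ((hasDerivAt_id x).sub_const c).const_mul μ
  have hW : ∀ x ∈ Icc c d,
      0 ≤ v x * Real.cosh (μ * (x - c)) - w x * (μ * Real.sinh (μ * (x - c))) := by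
    have hm : MonotoneOn
        (fun x ↦ v x * Real.cosh (μ * (x - c)) - w x * (μ * Real.sinh (μ * (x - c)))) (Icc c d) := by
      refine monotoneOn_Icc_of_hasDerivAt (fun x hx ↦
        ((h x (hsub hx)).2.mul (hs x).cosh).sub
          ((h x (hsub hx)).1.mul ((hs x).sinh.const_mul μ))) fun x hx ↦ ?_
      have h1 : 0 ≤ μ ^ 2 * (-(A x) * f (w x)) * Real.cosh (μ * (x - c)) := by
        have := hA x hx
        have := hf (w x)
        have := Real.cosh_pos (μ * (x - c))
        have : 0 ≤ -(A x) := by linarith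
        positivity
      linarith
    intro x hx
    have := hm (left_mem_Icc.2 (hx.1.trans hx.2)) hx hx.1
    simp only [sub_self, mul_zero, Real.cosh_zero, Real.sinh_zero, mul_one, sub_zero] at this
    exact hv.trans this
  have hq : MonotoneOn (fun x ↦ w x / Real.cosh (μ * (x - c))) (Icc c d) := by
    refine monotoneOn_Icc_of_hasDerivAt (fun x hx ↦
      (h x (hsub hx)).1.div (hs x).cosh (Real.cosh_pos _).ne') fun x hx ↦ ?_
    refine div_nonneg ?_ (sq_nonneg _)
    have := hW x hx
    linarith
  intro x hx
  have := hq (left_mem_Icc.2 (hx.1.trans hx.2)) hx hx.1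
  simp only [sub_self, mul_zero, Real.cosh_zero, div_one] at this
  rwa [le_div_iff₀ (Real.cosh_pos _)] at this

lemma cosh_le' (h : IsTrajectory T μ A f w v) (hμ : 0 < μ) (hf : ∀ u, 0 ≤ f u) {c d : ℝ}
    (hc : 0 ≤ c) (hd : d ≤ T) (hA : ∀ x ∈ Icc c d, A x ≤ 0) (hv : v d ≤ 0) :
    ∀ x ∈ Icc c d, w d * Real.cosh (μ * (d - x)) ≤ w x := by
  intro x hx
  have := h.reflect.cosh_le hμ hf (c := T - d) (d := T - c) (by linarith) (by linarith)
    (fun y hy ↦ hA _ ⟨by linarith [hy.2], by linarith [hy.1]⟩) (by simpa using hv) (T - x)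
    ⟨by linarith [hx.2], by linarith [hx.1]⟩
  simpa [sub_sub_sub_cancel_left] using this

lemma wronskian_sinh_nonpos (h : IsTrajectory T μ A f w v) (hμ : 0 < μ) (hf : ∀ u, 0 ≤ f u)
    {c d : ℝ} (hc : 0 ≤ c) (hd : d ≤ T) (hA : ∀ x ∈ Icc c d, 0 ≤ A x) (hw : 0 ≤ w c) :
    ∀ x ∈ Icc c d, v x * Real.sinh (μ * (x - c)) ≤ w x * (μ * Real.cosh (μ * (x - c))) := by
  have hsub : Icc c d ⊆ Icc 0 T := Icc_subset_Icc hc hd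
  have hs : ∀ x : ℝ, HasDerivAt (fun x ↦ μ * (x - c)) μ x := fun x ↦ by
    simpa using ((hasDerivAt_id x).sub_const c).const_mul μ
  have hm : AntitoneOn
      (fun x ↦ v x * Real.sinh (μ * (x - c)) - w x * (μ * Real.cosh (μ * (x - c)))) (Icc c d) := by
    refine antitoneOn_Icc_of_hasDerivAt (fun x hx ↦
      ((h x (hsub hx)).2.mul (hs x).sinh).sub
        ((h x (hsub hx)).1.mul ((hs x).cosh.const_mul μ))) fun x hx ↦ ?_
    have h1 : 0 ≤ μ ^ 2 * (A x * f (w x)) * Real.sinh (μ * (x - c)) := by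
      have := hA x hx
      have := hf (w x)
      have : 0 ≤ Real.sinh (μ * (x - c)) :=
        Real.sinh_nonneg_iff.2 (mul_nonneg hμ.le (by linarith [hx.1]))
      positivity
    linarith
  intro x hx
  have := hm (left_mem_Icc.2 (hx.1.trans hx.2)) hx hx.1
  simp only [sub_self, mul_zero, Real.cosh_zero, Real.sinh_zero, mul_one] at this
  nlinarith

/-- Where the weight is nonnegative, `w / sinh (μ (x - c))` is nonincreasing. -/
lemma mul_sinh_le (h : IsTrajectory T μ A f w v) (hμ : 0 < μ) (hf : ∀ u, 0 ≤ f u)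
    {c d : ℝ} (hc : 0 ≤ c) (hd : d ≤ T) (hA : ∀ x ∈ Icc c d, 0 ≤ A x) (hw : 0 ≤ w c)
    {y x : ℝ} (hy : c < y) (hyx : y ≤ x) (hx : x ≤ d) :
    w x * Real.sinh (μ * (y - c)) ≤ w y * Real.sinh (μ * (x - c)) := by
  have hsub : Icc y d ⊆ Icc c d := Icc_subset_Icc_left hy.le
  have hs : ∀ x : ℝ, HasDerivAt (fun x ↦ μ * (x - c)) μ x := fun x ↦ by
    simpa using ((hasDerivAt_id x).sub_const c).const_mul μ
  have hpos : ∀ z ∈ Icc y d, 0 < Real.sinh (μ * (z - c)) := fun z hz ↦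
    Real.sinh_pos_iff.2 (mul_pos hμ (by linarith [hz.1]))
  have hq : AntitoneOn (fun x ↦ w x / Real.sinh (μ * (x - c))) (Icc y d) := by
    refine antitoneOn_Icc_of_hasDerivAt (fun z hz ↦
      (h z (Icc_subset_Icc hc hd (hsub hz))).1.div (hs z).sinh (hpos z hz).ne') fun z hz ↦ ?_
    refine div_nonpos_of_nonpos_of_nonneg ?_ (sq_nonneg _)
    have := h.wronskian_sinh_nonpos hμ hf hc hd hA hw z (hsub hz)
    linarith
  have hyd : y ≤ d := hyx.trans hx
  have := hq (left_mem_Icc.2 hyd) ⟨hyx, hx⟩ hyx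
  simp only at this
  rwa [div_le_div_iff₀ (hpos x ⟨hyx, hx⟩) (hpos y (left_mem_Icc.2 hyd))] at this

lemma mul_sinh_le' (h : IsTrajectory T μ A f w v) (hμ : 0 < μ) (hf : ∀ u, 0 ≤ f u)
    {c d : ℝ} (hc : 0 ≤ c) (hd : d ≤ T) (hA : ∀ x ∈ Icc c d, 0 ≤ A x) (hw : 0 ≤ w d)
    {y x : ℝ} (hy : y < d) (hyx : x ≤ y) (hx : c ≤ x) :
    w x * Real.sinh (μ * (d - y)) ≤ w y * Real.sinh (μ * (d - x)) := by
  have := h.reflect.mul_sinh_le hμ hf (c := T - d) (d := T - c) (by linarith) (by linarith)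
    (fun y hy ↦ hA _ ⟨by linarith [hy.2], by linarith [hy.1]⟩) (by simpa using hw)
    (y := T - y) (x := T - x) (by linarith) (by linarith) (by linarith)
  simpa [sub_sub_sub_cancel_left] using this

lemma wronskian_sinh_nonpos' (h : IsTrajectory T μ A f w v) (hμ : 0 < μ) (hf : ∀ u, 0 ≤ f u)
    {c d : ℝ} (hc : 0 ≤ c) (hd : d ≤ T) (hA : ∀ x ∈ Icc c d, 0 ≤ A x) (hw : 0 ≤ w d) :
    ∀ x ∈ Icc c d, -v x * Real.sinh (μ * (d - x)) ≤ w x * (μ * Real.cosh (μ * (d - x))) := by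
  intro x hx
  have := h.reflect.wronskian_sinh_nonpos hμ hf (c := T - d) (d := T - c)
    (by linarith) (by linarith)
    (fun y hy ↦ hA _ ⟨by linarith [hy.2], by linarith [hy.1]⟩) (by simpa using hw) (T - x)
    ⟨by linarith [hx.2], by linarith [hx.1]⟩
  simpa [sub_sub_sub_cancel_left] using this

/-- Sturm comparison: a nonnegative trajectory cannot stay large where the weight is positive. -/
lemma exists_le_of_superlinear (h : IsTrajectory T μ A f w v) (hμ : 1 ≤ μ)
    {α β C : ℝ} (hα : 0 ≤ α) (hαβ : α < β) (hβ : β ≤ T) (hC : 0 < C)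
    (hbig : ∀ x ∈ Icc α β, ∀ u, C ≤ u → (1 + (Real.pi / (β - α)) ^ 2) * u ≤ A x * f u) :
    ∃ y ∈ Icc α β, w y ≤ C := by
  by_contra! hcon
  set ν := Real.pi / (β - α) with hν
  have hba : 0 < β - α := by linarith
  have hνpos : 0 < ν := div_pos Real.pi_pos hba
  have hs : ∀ x : ℝ, HasDerivAt (fun x ↦ ν * (x - α)) ν x := fun x ↦ by
    simpa using ((hasDerivAt_id x).sub_const α).const_mul ν
  have hsub : Icc α β ⊆ Icc 0 T := Icc_subset_Icc hα hβ
  have hm : AntitoneOn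
      (fun x ↦ v x * Real.sin (ν * (x - α)) - w x * (ν * Real.cos (ν * (x - α)))) (Icc α β) := by
    refine antitoneOn_Icc_of_hasDerivAt (fun x hx ↦
      ((h x (hsub hx)).2.mul (hs x).sin).sub
        ((h x (hsub hx)).1.mul ((hs x).cos.const_mul ν))) fun x hx ↦ ?_
    have h0 : 0 ≤ Real.sin (ν * (x - α)) := by
      refine Real.sin_nonneg_of_nonneg_of_le_pi (mul_nonneg hνpos.le (by linarith [hx.1])) ?_
      calc ν * (x - α) ≤ ν * (β - α) := by gcongr; exact hx.2
        _ = Real.pi := by rw [hν]; field_simp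
    have h1 := hbig x hx (w x) (hcon x hx).le
    have h2 : 0 < w x := hC.trans (hcon x hx)
    have h3 : μ ^ 2 * (w x - A x * f (w x)) + ν ^ 2 * w x ≤ 0 := by
      have h4 : w x - A x * f (w x) ≤ -(ν ^ 2 * w x) := by linarith
      have h5 : (1 : ℝ) ≤ μ ^ 2 := one_le_pow₀ hμ
      have h6 : 0 ≤ ν ^ 2 * w x := by positivity
      nlinarith [mul_le_mul_of_nonneg_left h4 (by positivity : 0 ≤ μ ^ 2)]
    have h4 := mul_nonneg (neg_nonneg.2 h3) h0
    linarith
  have := hm (left_mem_Icc.2 hαβ.le) (right_mem_Icc.2 hαβ.le) hαβ.le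
  have hπ : ν * (β - α) = Real.pi := by rw [hν]; field_simp
  simp only [hπ, sub_self, mul_zero, Real.cos_zero, Real.sin_zero, Real.sin_pi, Real.cos_pi] at this
  have h1 := hcon α (left_mem_Icc.2 hαβ.le)
  have h2 := hcon β (right_mem_Icc.2 hαβ.le)
  nlinarith

/-- If the maximum of a trajectory over `[c, d]` is at a level where the equation is convex, and it
is not attained at `c`, then it is attained at `d`. -/
lemma eq_and_deriv_nonneg_of_max (h : IsTrajectory T μ A f w v) (hμ : 0 < μ) {c d κ : ℝ}
    (hc : 0 ≤ c) (hcd : c < d) (hd : d ≤ T) (hsmall : ∀ x ∈ Icc 0 T, A x * f κ < κ)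
    (hle : ∀ x ∈ Icc c d, w x ≤ κ) (hex : ∃ x ∈ Icc c d, w x = κ) (hne : w c ≠ κ) :
    w d = κ ∧ 0 ≤ v d := by
  obtain ⟨x, hx, hxκ⟩ := hex
  have hcx : c < x := lt_of_le_of_ne hx.1 (by rintro rfl; exact hne hxκ)
  have hxd : x = d := by
    by_contra hxd
    have hxd : x < d := lt_of_le_of_ne hx.2 hxd
    have hmax : IsLocalMax w x := by
      filter_upwards [Icc_mem_nhds hcx hxd] with z hz
      rw [hxκ]; exact hle z hz
    have hxT : x ∈ Ioo 0 T := ⟨hc.trans_lt hcx, hxd.trans_le hd⟩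
    have := h.le_of_isLocalMax hμ hxT hmax
    rw [hxκ] at this
    linarith [hsmall x ⟨hxT.1.le, hxT.2.le⟩]
  subst hxd
  exact ⟨hxκ, deriv_nonneg_of_le_right_endpoint hcd (h x ⟨hc.trans hcx.le, hd⟩).1
    fun z hz ↦ by rw [hxκ]; exact hle z hz⟩

end IsTrajectory

/-- The power `u ^ p`, extended by `0` to the left of `0` and linearly to the right of `M`. -/
noncomputable def truncPow (p M u : ℝ) : ℝ := u * (min (max u 0) M) ^ (p - 1)

section TruncPow

variable {p M : ℝ}

lemma truncPow_of_nonpos (hp : 1 < p) (hM : 0 < M) {u : ℝ} (hu : u ≤ 0) : truncPow p M u = 0 := by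
  rw [truncPow, max_eq_right hu, min_eq_left hM.le, Real.zero_rpow (by linarith), mul_zero]

lemma truncPow_nonneg (hp : 1 < p) (hM : 0 < M) (u : ℝ) : 0 ≤ truncPow p M u := by
  rcases le_total u 0 with hu | hu
  · rw [truncPow_of_nonpos hp hM hu]
  · exact mul_nonneg hu (Real.rpow_nonneg (le_min (le_max_right _ _) hM.le) _)

lemma truncPow_eq_rpow (hp : 1 < p) {u : ℝ} (hu : 0 ≤ u) (huM : u ≤ M) :
    truncPow p M u = u ^ p := by
  rw [truncPow, max_eq_left hu, min_eq_left huM]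
  rcases hu.eq_or_lt with rfl | hu
  · rw [zero_mul, Real.zero_rpow (by linarith)]
  · rw [← Real.rpow_one_add' hu.le (by linarith)]; congr 1; ring

lemma truncPow_le (hp : 1 < p) (hM : 0 < M) {u κ : ℝ} (hu : 0 ≤ u) (huκ : u ≤ κ) :
    truncPow p M u ≤ κ ^ (p - 1) * u := by
  rw [truncPow, mul_comm, max_eq_left hu]
  gcongr
  · exact min_le_left _ _ |>.trans huκ

lemma le_truncPow (hp : 1 < p) {u C : ℝ} (hC : 0 < C) (hCM : C ≤ M) (hu : C ≤ u) :
    C ^ (p - 1) * u ≤ truncPow p M u := by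
  rw [truncPow, mul_comm, max_eq_left (hC.le.trans hu)]
  have : 0 ≤ u := hC.le.trans hu
  gcongr
  exact le_min hu hCM

lemma truncPow_eq_add (hp : 1 < p) (hM : 0 < M) (u : ℝ) :
    truncPow p M u = (min (max u 0) M) ^ p + M ^ (p - 1) * (max u M - M) := by
  rcases le_total u 0 with hu | hu
  · rw [truncPow_of_nonpos hp hM hu, max_eq_right hu, min_eq_left hM.le,
      Real.zero_rpow (by linarith), max_eq_right (hu.trans hM.le)]
    ring
  rcases le_total u M with huM | huM
  · rw [truncPow_eq_rpow hp hu huM, max_eq_left hu, min_eq_left huM, max_eq_right huM]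
    ring
  · rw [truncPow, max_eq_left hu, min_eq_right huM, max_eq_left huM]
    have : M ^ p = M * M ^ (p - 1) := by
      rw [← Real.rpow_one_add' hM.le (by linarith)]; congr 1; ring
    rw [this]; ring

lemma exists_lipschitz_truncPow (hp : 1 < p) (hM : 0 < M) :
    ∃ K : ℝ, 0 ≤ K ∧ ∀ u u', |truncPow p M u - truncPow p M u'| ≤ K * |u - u'| := by
  have hMp : 0 ≤ M ^ (p - 1) := Real.rpow_nonneg hM.le _
  refine ⟨p * M ^ (p - 1) + M ^ (p - 1), by nlinarith, fun u u' ↦ ?_⟩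
  have hcl : ∀ y : ℝ, min (max y 0) M ∈ Icc 0 M := fun y ↦
    ⟨le_min (le_max_right _ _) hM.le, min_le_right _ _⟩
  have hpow : ∀ x ∈ Icc 0 M, ∀ y ∈ Icc 0 M, |y ^ p - x ^ p| ≤ p * M ^ (p - 1) * |y - x| := by
    intro x hx y hy
    refine Convex.norm_image_sub_le_of_norm_hasDerivWithin_le (f := fun x : ℝ ↦ x ^ p)
      (fun z hz ↦ (Real.hasDerivAt_rpow_const (Or.inr hp.le)).hasDerivWithinAt) (fun z hz ↦ ?_)
      (convex_Icc 0 M) hx hy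
    rw [Real.norm_of_nonneg (mul_nonneg (by linarith) (Real.rpow_nonneg hz.1 _))]
    gcongr
    · exact hz.1
    · exact hz.2
  have h1 := hpow _ (hcl u') _ (hcl u)
  have h2 : |min (max u 0) M - min (max u' 0) M| ≤ |u - u'| :=
    (abs_min_sub_min_le_max _ _ _ _).trans (by
      rw [sub_self, abs_zero, max_eq_left (abs_nonneg _)]
      refine (abs_max_sub_max_le_max _ _ _ _).trans ?_
      rw [sub_self, abs_zero, max_eq_left (abs_nonneg _)])
  have h3 : |max u M - max u' M| ≤ |u - u'| :=
    (abs_max_sub_max_le_max _ _ _ _).trans (by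
      rw [sub_self, abs_zero, max_eq_left (abs_nonneg _)])
  rw [truncPow_eq_add hp hM, truncPow_eq_add hp hM]
  calc _ = |(min (max u 0) M ^ p - min (max u' 0) M ^ p)
        + M ^ (p - 1) * (max u M - max u' M)| := by ring_nf
    _ ≤ |min (max u 0) M ^ p - min (max u' 0) M ^ p| + |M ^ (p - 1) * (max u M - max u' M)| :=
        abs_add_le _ _
    _ ≤ p * M ^ (p - 1) * |u - u'| + M ^ (p - 1) * |u - u'| := by
        rw [abs_mul, abs_of_nonneg hMp]
        gcongr
        exact h1.trans (mul_le_mul_of_nonneg_left h2 (by nlinarith))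
    _ = _ := by ring

lemma exists_linear_bound {μ B : ℝ} {A : ℝ → ℝ} (hA : ∀ x, |A x| ≤ B) (hp : 1 < p) (hM : 0 < M) :
    ∃ K : ℝ, 0 ≤ K ∧ ∀ x u u', |μ ^ 2 * (u - A x * truncPow p M u)
      - μ ^ 2 * (u' - A x * truncPow p M u')| ≤ K * |u - u'| := by
  obtain ⟨K, hK, hlip⟩ := exists_lipschitz_truncPow hp hM
  have hB : 0 ≤ B := (abs_nonneg _).trans (hA 0)
  refine ⟨μ ^ 2 * (1 + B * K), by positivity, fun x u u' ↦ ?_⟩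
  rw [← mul_sub, abs_mul, abs_of_nonneg (sq_nonneg μ), mul_assoc]
  gcongr
  calc _ = |(u - u') - A x * (truncPow p M u - truncPow p M u')| := by ring_nf
    _ ≤ |u - u'| + |A x * (truncPow p M u - truncPow p M u')| := abs_sub _ _
    _ ≤ |u - u'| + B * (K * |u - u'|) := by
        rw [abs_mul]
        gcongr
        · exact hA x
        · exact hlip u u'
    _ = _ := by ring

end TruncPow

/-- The trajectories issuing from `0` with slope `s ∈ [0, S]` form a continuous family. -/
lemma exists_family_of_trajectories {T μ K S : ℝ} {A f : ℝ → ℝ} (hT : 0 < T) (hS : 0 ≤ S)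
    (hA : Continuous A) (hK : 0 ≤ K) (hf0 : f 0 = 0)
    (hlip : ∀ x u u', |μ ^ 2 * (u - A x * f u) - μ ^ 2 * (u' - A x * f u')| ≤ K * |u - u'|) :
    ∃ W V : ℝ → ℝ → ℝ, Continuous ↿W ∧ (∀ s, IsTrajectory T μ A f (W s) (V s)) ∧
      (∀ s, W s 0 = 0) ∧ ∀ s ∈ Icc 0 S, V s 0 = s := by
  set R : ℝ := Real.exp ((1 + K) * T) * (S + 1) with hR
  have hexp : 1 ≤ Real.exp ((1 + K) * T) := Real.one_le_exp (by positivity)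
  have hRpos : 0 < R := by positivity
  set cl : ℝ → ℝ := fun u ↦ max (-R) (min u R) with hcl
  have cl_abs : ∀ u, |cl u| ≤ R := fun u ↦
    abs_le.2 ⟨le_max_left _ _, max_le (by linarith) (min_le_right _ _)⟩
  have cl_lip : ∀ u u', |cl u - cl u'| ≤ |u - u'| := fun u u' ↦ by
    refine (abs_max_sub_max_le_max _ _ _ _).trans ?_
    rw [sub_self, abs_zero, max_eq_right (abs_nonneg _)]
    refine (abs_min_sub_min_le_max _ _ _ _).trans ?_
    rw [sub_self, abs_zero, max_eq_left (abs_nonneg _)]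
  have cl_zero : cl 0 = 0 := by simp [hcl, hRpos.le]
  have cl_le : ∀ u, |cl u| ≤ |u| := fun u ↦ by simpa [cl_zero] using cl_lip u 0
  have cl_eq : ∀ u, |u| ≤ R → cl u = u := fun u hu ↦ by
    rw [abs_le] at hu; simp [hcl, min_eq_left hu.2, max_eq_right hu.1]
  set g : ℝ → ℝ → ℝ := fun x u ↦ μ ^ 2 * (u - A x * f u) with hg
  have g_le : ∀ x u, |g x u| ≤ K * |u| := fun x u ↦ by
    have := hlip x u 0
    rwa [hf0, mul_zero, sub_zero, mul_zero, sub_zero, sub_zero] at this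
  set F : ℝ → ℝ × ℝ → ℝ × ℝ := fun x z ↦ (cl z.2, g x (cl z.1)) with hF
  set r : NNReal := ⟨S, hS⟩
  set b : NNReal := ⟨(1 + K) * R, by positivity⟩
  set K' : NNReal := ⟨1 + K, by positivity⟩
  set ρ : NNReal := ⟨(1 + K) * R * (T + 1) + S, by positivity⟩
  have h0mem : (0 : ℝ) ∈ Icc (-1) (T + 1) := ⟨by norm_num, by linarith⟩
  have hPL : IsPicardLindelof F (tmin := -1) (tmax := T + 1) ⟨0, h0mem⟩ (0 : ℝ × ℝ) ρ r b K' := by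
    refine ⟨fun t _ ↦ LipschitzWith.lipschitzOnWith (LipschitzWith.of_dist_le_mul fun z z' ↦ ?_),
      fun z _ ↦ ?_, fun t _ z _ ↦ ?_, ?_⟩
    · rw [Prod.dist_eq, max_le_iff]
      have h1 : |z.1 - z'.1| ≤ dist z z' := by
        rw [← Real.dist_eq, Prod.dist_eq]; exact le_max_left _ _
      have h2 : |z.2 - z'.2| ≤ dist z z' := by
        rw [← Real.dist_eq, Prod.dist_eq]; exact le_max_right _ _
      have h3 : (0 : ℝ) ≤ dist z z' := dist_nonneg
      have hK'1 : (K' : ℝ) = 1 + K := rfl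
      rw [hK'1, Real.dist_eq, Real.dist_eq]
      constructor
      · have := (cl_lip z.2 z'.2).trans h2
        nlinarith
      · have h4 := (hlip t (cl z.1) (cl z'.1)).trans
          (mul_le_mul_of_nonneg_left ((cl_lip z.1 z'.1).trans h1) hK)
        exact h4.trans (by nlinarith)
    · exact (Continuous.prodMk continuous_const (by fun_prop)).continuousOn
    · have hb1 : (b : ℝ) = (1 + K) * R := rfl
      rw [hb1, Prod.norm_def, max_le_iff, Real.norm_eq_abs, Real.norm_eq_abs]
      have h1 := cl_abs z.2
      have h2 := (g_le t (cl z.1)).trans (mul_le_mul_of_nonneg_left (cl_abs z.1) hK)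
      constructor
      · exact h1.trans (by nlinarith)
      · exact h2.trans (by nlinarith)
    · change (1 + K) * R * max (T + 1 - 0) (0 - -1) ≤ (1 + K) * R * (T + 1) + S - S
      rw [max_eq_left (by linarith)]
      linarith
  obtain ⟨α, hα, hαc⟩ :=
    hPL.exists_forall_mem_closedBall_eq_hasDerivWithinAt_continuousOn
  set ps : ℝ → ℝ := fun s ↦ max 0 (min s S) with hps
  set px : ℝ → ℝ := fun x ↦ max (-1) (min x (T + 1)) with hpx
  have hps_mem : ∀ s, ps s ∈ Icc 0 S := fun s ↦ ⟨le_max_left _ _, max_le hS (min_le_right _ _)⟩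
  have hpx_mem : ∀ x, px x ∈ Icc (-1) (T + 1) := fun x ↦
    ⟨le_max_left _ _, max_le (by linarith) (min_le_right _ _)⟩
  have hball : ∀ s, ((0 : ℝ), ps s) ∈ Metric.closedBall (0 : ℝ × ℝ) r := fun s ↦ by
    rw [mem_closedBall_zero_iff, Prod.norm_def]
    simp only [norm_zero, Real.norm_eq_abs, abs_of_nonneg (hps_mem s).1]
    exact max_le hS (hps_mem s).2
  have hpx_eq : ∀ x ∈ Icc (-1) (T + 1), px x = x := fun x hx ↦ by
    simp [hpx, min_eq_left hx.2, max_eq_right hx.1]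
  refine ⟨fun s x ↦ (α ((0, ps s), px x)).1, fun s x ↦ (α ((0, ps s), px x)).2, ?_, ?_, ?_, ?_⟩
  · have h1 : Continuous fun q : ℝ × ℝ ↦ (((0 : ℝ), ps q.1), px q.2) := by fun_prop
    exact continuous_fst.comp
      (hαc.comp_continuous h1 fun q ↦ ⟨hball q.1, hpx_mem q.2⟩)
  · intro s
    obtain ⟨hα0, hαd⟩ := hα _ (hball s)
    set z : ℝ → ℝ × ℝ := fun x ↦ α ((0, ps s), px x) with hz
    have hzd : ∀ x ∈ Icc 0 T, HasDerivAt z (F x (z x)) x := by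
      intro x hx
      have hx1 : -1 < x := by linarith [hx.1]
      have hx2 : x < T + 1 := by linarith [hx.2]
      have h1 := (hαd x ⟨hx1.le, hx2.le⟩).hasDerivAt (Icc_mem_nhds hx1 hx2)
      have h2 : z x = α ((0, ps s), x) := by simp only [hz, hpx_eq x ⟨hx1.le, hx2.le⟩]
      rw [h2]
      refine h1.congr_of_eventuallyEq ?_
      filter_upwards [Icc_mem_nhds hx1 hx2] with y hy
      simp only [hz, hpx_eq y hy]
    have hw : ∀ x ∈ Icc 0 T, HasDerivAt (fun x ↦ (z x).1) (cl (z x).2) x := fun x hx ↦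
      (hasFDerivAt_fst (𝕜 := ℝ) (p := z x)).comp_hasDerivAt x (hzd x hx)
    have hv : ∀ x ∈ Icc 0 T, HasDerivAt (fun x ↦ (z x).2) (g x (cl (z x).1)) x := fun x hx ↦
      (hasFDerivAt_snd (𝕜 := ℝ) (p := z x)).comp_hasDerivAt x (hzd x hx)
    have hz0 : z 0 = (0, ps s) := by
      simp only [hz, hpx_eq 0 h0mem]; exact hα0
    have hbound : ∀ x ∈ Icc 0 T, |(z x).1| ≤ R ∧ |(z x).2| ≤ R := by
      intro x hx
      have h1 := sq_add_sq_le_of_linear_growth hK hw hv (fun x _ ↦ cl_le _)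
        (fun x _ ↦ (g_le x _).trans (mul_le_mul_of_nonneg_left (cl_le _) hK))
        (left_mem_Icc.2 hT.le) hx
      rw [hz0] at h1
      have h2 : (z x).1 ^ 2 + (z x).2 ^ 2 ≤ R ^ 2 := by
        refine h1.trans ?_
        have h3 : (ps s) ^ 2 ≤ (S + 1) ^ 2 :=
          pow_le_pow_left₀ (hps_mem s).1 (by linarith [(hps_mem s).2]) 2
        rw [hR, mul_pow]
        have h4 : Real.exp ((1 + K) * T) ≤ Real.exp ((1 + K) * T) ^ 2 :=
          le_self_pow₀ hexp two_ne_zero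
        have h5 : (0 : ℝ) ^ 2 + ps s ^ 2 ≤ (S + 1) ^ 2 := by linarith
        exact mul_le_mul h4 h5 (by positivity) (by positivity)
      constructor
      · exact abs_le_of_sq_le_sq (by nlinarith [sq_nonneg (z x).2]) hRpos.le
      · exact abs_le_of_sq_le_sq (by nlinarith [sq_nonneg (z x).1]) hRpos.le
    intro x hx
    obtain ⟨h1, h2⟩ := hbound x hx
    refine ⟨(hw x hx).congr_deriv (cl_eq _ h2), (hv x hx).congr_deriv ?_⟩
    rw [cl_eq _ h1]
  · intro s
    simp only [hpx_eq 0 h0mem]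
    exact congrArg Prod.fst (hα _ (hball s)).1
  · intro s hs
    simp only [hpx_eq 0 h0mem]
    refine (congrArg Prod.snd (hα _ (hball s)).1).trans ?_
    simp [hps, min_eq_left hs.2, max_eq_right hs.1]

lemma exists_first_hit {g : ℝ → ℝ} (hg : Continuous g) {a b k : ℝ} (hab : a ≤ b) (ha : g a ≤ k)
    (hb : k ≤ g b) : ∃ c ∈ Icc a b, g c = k ∧ ∀ t ∈ Icc a c, g t ≤ k := by
  have hcomp : IsCompact (Icc a b ∩ {t | k ≤ g t}) :=
    isCompact_Icc.inter_right (isClosed_le continuous_const hg)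
  obtain ⟨c, ⟨hc, hkc⟩, hleast⟩ := hcomp.exists_isLeast ⟨b, right_mem_Icc.2 hab, hb⟩
  have hgc : g c = k := by
    obtain ⟨c', hc', hk⟩ := intermediate_value_Icc hc.1 hg.continuousOn ⟨ha, hkc⟩
    have := hleast ⟨⟨hc'.1, hc'.2.trans hc.2⟩, hk.ge⟩
    rw [le_antisymm this hc'.2, hk]
  refine ⟨c, hc, hgc, fun t ht ↦ ?_⟩
  by_contra! hlt
  have := hleast ⟨⟨ht.1, ht.2.trans hc.2⟩, hlt.le⟩
  rw [le_antisymm ht.2 this, hgc] at hlt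
  exact lt_irrefl _ hlt

lemma exists_last_hit {g : ℝ → ℝ} (hg : Continuous g) {a b k : ℝ} (hab : a ≤ b) (ha : g a ≤ k)
    (hb : k ≤ g b) : ∃ c ∈ Icc a b, g c = k ∧ ∀ t ∈ Icc c b, k ≤ g t := by
  obtain ⟨c, hc, hck, hle⟩ := exists_first_hit (g := fun t ↦ -g (-t)) (by fun_prop)
    (neg_le_neg hab) (k := -k) (by simpa using hb) (by simpa using ha)
  refine ⟨-c, ⟨by linarith [hc.2], by linarith [hc.1]⟩, by linarith, fun t ht ↦ ?_⟩
  have := hle (-t) ⟨by linarith [ht.2], by linarith [ht.1]⟩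
  rw [neg_neg] at this
  linarith

/-- A path of trajectories that crosses `[c, d]` from the nonpositive ones to one that exceeds `κ`
and is negative at `d` contains two subpaths, one staying below `κ` and the other one reaching `κ`,
both joining at `d` the level `0` to the level `κ`. -/
lemma exists_subpaths {W V : ℝ → ℝ → ℝ} {θ : ℝ → ℝ} {c d κ : ℝ} (hW : Continuous ↿W)
    (hθ : Continuous θ) (hcd : c ≤ d) (hκ : 0 < κ) (hstart : ∀ x ∈ Icc c d, W (θ 0) x ≤ 0)
    (hend : W (θ 1) d < 0) (hbig : ∃ x ∈ Icc c d, κ < W (θ 1) x)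
    (htouch : ∀ t ∈ Icc (0 : ℝ) 1, (∀ x ∈ Icc c d, W (θ t) x ≤ κ) →
      (∃ x ∈ Icc c d, W (θ t) x = κ) → W (θ t) d = κ ∧ 0 ≤ V (θ t) d) (b : Prop) :
    ∃ φ : ℝ → ℝ, Continuous φ ∧ (∀ t ∈ Icc (0 : ℝ) 1, φ t ∈ Icc (0 : ℝ) 1) ∧
      W (θ (φ 0)) d = 0 ∧ W (θ (φ 1)) d = κ ∧ 0 ≤ V (θ (φ 1)) d ∧
      ∀ t ∈ Icc (0 : ℝ) 1, 0 ≤ W (θ (φ t)) d ∧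
        (b → ∃ x ∈ Icc c d, κ ≤ W (θ (φ t)) x) ∧ (¬b → ∀ x ∈ Icc c d, W (θ (φ t)) x ≤ κ) := by
  have hWθ : Continuous ↿(fun t x ↦ W (θ t) x) :=
    hW.comp (Continuous.prodMk (hθ.comp continuous_fst) continuous_snd)
  have hWt : ∀ t, Continuous (W (θ t)) := fun t ↦ hWθ.comp (Continuous.prodMk_right t)
  set m : ℝ → ℝ := fun t ↦ sSup (W (θ t) '' Icc c d) with hm
  have hmc : Continuous m := isCompact_Icc.continuous_sSup hWθ
  have hle_m : ∀ t, ∀ x ∈ Icc c d, W (θ t) x ≤ m t := fun t x hx ↦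
    le_csSup (isCompact_Icc.image (hWt t)).bddAbove (mem_image_of_mem _ hx)
  have hm_mem : ∀ t, ∃ x ∈ Icc c d, W (θ t) x = m t := fun t ↦
    (isCompact_Icc.image (hWt t)).sSup_mem ((nonempty_Icc.2 hcd).image _)
  have hm0 : m 0 ≤ κ := by
    obtain ⟨x, hx, hxm⟩ := hm_mem 0
    rw [← hxm]; exact (hstart x hx).trans hκ.le
  have hm1 : κ ≤ m 1 := by
    obtain ⟨x, hx, hxm⟩ := hbig
    exact hxm.le.trans (hle_m 1 x hx)
  have hgc : Continuous fun t ↦ W (θ t) d := hWθ.comp (Continuous.prodMk_left d)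
  have hseg : ∀ r s t : ℝ, r ≤ s → t ∈ Icc (0 : ℝ) 1 →
      r + t * (s - r) ∈ Icc r s ∧ s + t * (r - s) ∈ Icc r s := by
    intro r s t hrs ht
    have h1 : 0 ≤ t * (s - r) := mul_nonneg ht.1 (by linarith)
    have h2 : t * (s - r) ≤ s - r := mul_le_of_le_one_left (by linarith) ht.2
    exact ⟨⟨by linarith, by linarith⟩, ⟨by linarith, by linarith⟩⟩
  by_cases hb : b
  · obtain ⟨r, hr, hrm, hrle⟩ := exists_last_hit hmc zero_le_one hm0 hm1
    obtain ⟨hr1, hr2⟩ := htouch r hr (fun x hx ↦ (hle_m r x hx).trans hrm.le)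
      (by simpa [hrm] using hm_mem r)
    obtain ⟨s, hs, hsm, hsle⟩ := exists_first_hit (g := fun t ↦ -W (θ t) d) hgc.neg hr.2
      (k := 0) (by rw [hr1]; linarith) (by linarith)
    refine ⟨fun t ↦ s + t * (r - s), by fun_prop, fun t ht ↦ ?_, ?_, ?_, ?_, fun t ht ↦
      ⟨?_, fun _ ↦ ?_, fun h ↦ absurd hb h⟩⟩
    · have := (hseg r s t hs.1 ht).2
      exact ⟨hr.1.trans this.1, this.2.trans hs.2⟩
    · simpa using hsm
    · simpa using hr1
    · simpa using hr2
    · linarith [hsle _ (hseg r s t hs.1 ht).2]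
    · obtain ⟨x, hx, hxm⟩ := hm_mem (s + t * (r - s))
      have := (hseg r s t hs.1 ht).2
      exact ⟨x, hx, hxm ▸ hrle _ ⟨this.1, this.2.trans hs.2⟩⟩
  · obtain ⟨s, hs, hsm, hsle⟩ := exists_first_hit hmc zero_le_one hm0 hm1
    obtain ⟨hs1, hs2⟩ := htouch s hs (fun x hx ↦ (hle_m s x hx).trans hsm.le)
      (by simpa [hsm] using hm_mem s)
    obtain ⟨r, hr, hrm, hrle⟩ := exists_last_hit (g := fun t ↦ W (θ t) d) hgc hs.1
      (k := 0) (hstart d (right_mem_Icc.2 hcd)) (by linarith)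
    refine ⟨fun t ↦ r + t * (s - r), by fun_prop, fun t ht ↦ ?_, ?_, ?_, ?_, fun t ht ↦
      ⟨?_, fun h ↦ absurd h hb, fun _ x hx ↦ ?_⟩⟩
    · have := (hseg r s t hr.2 ht).1
      exact ⟨hr.1.trans this.1, this.2.trans hs.2⟩
    · simpa using hrm
    · simpa using hs1
    · simpa using hs2
    · exact hrle _ (hseg r s t hr.2 ht).1
    · have := (hseg r s t hr.2 ht).1
      exact (hle_m _ x hx).trans (hsle _ ⟨hr.1.trans this.1, this.2⟩)

section Bounds

variable {T p c d : ℝ} {A : ℝ → ℝ}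

lemma exists_sublevel_point {α β : ℝ} (hA : Continuous A) (hp : 1 < p) (hc : 0 ≤ c) (hcα : c < α)
    (hαβ : α < β) (hβd : β < d) (hd : d ≤ T) (hpos : ∀ x ∈ Ioo c d, 0 < A x) :
    ∃ C > 0, ∀ M, C ≤ M → ∀ μ, 1 ≤ μ → ∀ w v, IsTrajectory T μ A (truncPow p M) w v →
      ∃ y ∈ Icc α β, w y ≤ C := by
  obtain ⟨z, hz, hzmin⟩ := isCompact_Icc.exists_isMinOn (nonempty_Icc.2 hαβ.le) hA.continuousOn
  have ha0 : 0 < A z := hpos z ⟨hcα.trans_le hz.1, hz.2.trans_lt hβd⟩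
  set q := (1 + (Real.pi / (β - α)) ^ 2) / A z with hq
  have hq0 : 0 < q := by positivity
  have hC : 0 < q ^ (p - 1)⁻¹ := Real.rpow_pos_of_pos hq0 _
  have hCp : (q ^ (p - 1)⁻¹) ^ (p - 1) = q := Real.rpow_inv_rpow hq0.le (by linarith)
  refine ⟨q ^ (p - 1)⁻¹, hC, fun M hM μ hμ w v h ↦
    h.exists_le_of_superlinear hμ (hc.trans hcα.le) hαβ (hβd.le.trans hd) hC fun x hx u hu ↦ ?_⟩
  have h1 := le_truncPow hp hC hM hu
  rw [hCp] at h1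
  have hu0 : 0 < u := hC.trans_le hu
  have h2 : A z ≤ A x := hzmin hx
  have h3 : 0 ≤ A x := ha0.le.trans h2
  calc (1 + (Real.pi / (β - α)) ^ 2) * u = A z * (q * u) := by rw [hq]; field_simp
    _ ≤ A x * truncPow p M u := by gcongr

lemma nonneg_on_Icc_of_pos_on_Ioo (hA : Continuous A) (hcd : c < d)
    (hpos : ∀ x ∈ Ioo c d, 0 < A x) : ∀ x ∈ Icc c d, 0 ≤ A x := by
  intro x hx
  rw [← closure_Ioo hcd.ne] at hx
  exact closure_minimal (fun y hy ↦ (hpos y hy).le) (isClosed_le continuous_const hA) hx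

lemma exists_right_endpoint_bound {κ ℓ : ℝ} (hA : Continuous A) (hp : 1 < p) (hc : 0 ≤ c)
    (hcd : c < d) (hd : d ≤ T) (hpos : ∀ x ∈ Ioo c d, 0 < A x) (hκ : 0 < κ) (hℓ : 0 < ℓ) :
    ∃ C > 0, ∃ μ₀, ∀ M, C ≤ M → ∀ μ, 1 ≤ μ → μ₀ ≤ μ → ∀ w v,
      IsTrajectory T μ A (truncPow p M) w v → (∀ x ∈ Icc c d, 0 ≤ w x) →
      w d < κ * Real.cosh (μ * ℓ) := by
  set h := min ℓ (d - c) / 4 with hh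
  have hmin : 0 < min ℓ (d - c) := lt_min hℓ (by linarith)
  have h0 : 0 < h := by positivity
  have hℓ4 : 4 * h ≤ ℓ := by rw [hh]; linarith [min_le_left ℓ (d - c)]
  have hd4 : 4 * h ≤ d - c := by rw [hh]; linarith [min_le_right ℓ (d - c)]
  obtain ⟨C, hC, hsub⟩ := exists_sublevel_point (α := d - 2 * h) (β := d - h) hA hp hc
    (by linarith) (by linarith) (by linarith) hd hpos
  refine ⟨C, hC, max (1 / (4 * h)) (8 * C / (κ * ℓ)), fun M hM μ hμ hμ₀ w v htr hw ↦ ?_⟩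
  have hμ0 : 0 < μ := by linarith
  have hM0 : 0 < M := hC.trans_le hM
  obtain ⟨y, hy, hyC⟩ := hsub M hM μ hμ w v htr
  have h1 : 1 ≤ μ * (4 * h) := by
    have := (le_max_left _ _).trans hμ₀
    rwa [div_le_iff₀ (by positivity)] at this
  have h2 : 8 * C ≤ μ * (κ * ℓ) := by
    have := (le_max_right _ _).trans hμ₀
    rwa [div_le_iff₀ (by positivity)] at this
  have hyc : 2 * h ≤ y - c := by linarith [hy.1]
  have h3 := htr.mul_sinh_le hμ0 (truncPow_nonneg hp hM0) hc hd
    (nonneg_on_Icc_of_pos_on_Ioo hA hcd hpos) (hw c (left_mem_Icc.2 hcd.le))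
    (y := y) (x := d) (by linarith) (by linarith [hy.2]) le_rfl
  set P := μ * (y - c) with hP
  set Q := μ * (d - c) with hQ
  have hP2 : 1 / 2 ≤ P := by nlinarith
  have hQ0 : 0 ≤ Q := mul_nonneg hμ0.le (by linarith)
  have hexpP : Real.exp P / 4 ≤ Real.sinh P := by
    rw [Real.sinh_eq]
    have e1 : 2 ≤ Real.exp P * Real.exp P := by
      rw [← Real.exp_add]; linarith [Real.add_one_le_exp (P + P)]
    have e2 : Real.exp (-P) * Real.exp P = 1 := by rw [← Real.exp_add]; simp
    have e3 := Real.exp_pos P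
    have e4 := Real.exp_pos (-P)
    nlinarith
  have hsinhQ : Real.sinh Q ≤ Real.exp Q / 2 := by
    rw [Real.sinh_eq]; linarith [Real.exp_pos (-Q)]
  have hwd := hw d (right_mem_Icc.2 hcd.le)
  have h4 : w d * (Real.exp P / 4) ≤ C * (Real.exp Q / 2) := by
    calc w d * (Real.exp P / 4) ≤ w d * Real.sinh P := by gcongr
      _ ≤ w y * Real.sinh Q := h3
      _ ≤ C * Real.sinh Q := by
          have := Real.sinh_nonneg_iff.2 hQ0
          gcongr
      _ ≤ _ := by gcongr
  have hQP : Real.exp Q ≤ Real.exp P * Real.exp (μ * ℓ / 2) := by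
    rw [← Real.exp_add, Real.exp_le_exp]
    have : μ * (d - y) ≤ μ * (ℓ / 2) := by gcongr; linarith [hy.1]
    rw [hP, hQ]; linarith
  have h5 : w d ≤ 2 * C * Real.exp (μ * ℓ / 2) := by
    have e3 := Real.exp_pos P
    have : w d * Real.exp P ≤ 2 * C * Real.exp (μ * ℓ / 2) * Real.exp P := by nlinarith
    exact le_of_mul_le_mul_right this e3
  have h6 : 4 * C < κ * Real.exp (μ * ℓ / 2) := by
    have := Real.add_one_le_exp (μ * ℓ / 2)
    nlinarith
  have h7 : Real.exp (μ * ℓ) = Real.exp (μ * ℓ / 2) * Real.exp (μ * ℓ / 2) := by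
    rw [← Real.exp_add]; congr 1; ring
  rw [Real.cosh_eq, h7]
  have e5 := Real.exp_pos (μ * ℓ / 2)
  have e6 := Real.exp_pos (-(μ * ℓ))
  nlinarith [mul_lt_mul_of_pos_right h6 e5, mul_pos hκ e6]

lemma exists_left_endpoint_bound {κ ℓ : ℝ} (hA : Continuous A) (hp : 1 < p) (hc : 0 ≤ c)
    (hcd : c < d) (hd : d ≤ T) (hpos : ∀ x ∈ Ioo c d, 0 < A x) (hκ : 0 < κ) (hℓ : 0 < ℓ) :
    ∃ C > 0, ∃ μ₀, ∀ M, C ≤ M → ∀ μ, 1 ≤ μ → μ₀ ≤ μ → ∀ w v,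
      IsTrajectory T μ A (truncPow p M) w v → (∀ x ∈ Icc c d, 0 ≤ w x) →
      w c < κ * Real.cosh (μ * ℓ) := by
  obtain ⟨C, hC, μ₀, H⟩ := exists_right_endpoint_bound (T := T) (A := fun x ↦ A (T - x))
    (c := T - d) (d := T - c) (by fun_prop) hp (by linarith) (by linarith) (by linarith)
    (fun x hx ↦ hpos _ ⟨by linarith [hx.2], by linarith [hx.1]⟩) hκ hℓ
  refine ⟨C, hC, μ₀, fun M hM μ hμ hμ₀ w v h hw ↦ ?_⟩
  have := H M hM μ hμ hμ₀ _ _ h.reflect fun x hx ↦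
    hw _ ⟨by linarith [hx.2], by linarith [hx.1]⟩
  simpa using this

/-- A priori bounds, uniform in the truncation level. -/
lemma exists_uniform_bound (hA : Continuous A) (hp : 1 < p) (hc : 0 ≤ c)
    (hcd : c < d) (hd : d ≤ T) (hpos : ∀ x ∈ Ioo c d, 0 < A x) :
    ∃ C > 0, ∀ μ, 1 ≤ μ → ∃ D, ∀ M, C ≤ M → ∀ w v,
      IsTrajectory T μ A (truncPow p M) w v → (∀ x ∈ Icc c d, 0 ≤ w x) →
      (∀ x ∈ Icc c d, w x ≤ D) ∧ ∃ y ∈ Icc c d, |v y| ≤ D := by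
  set h := (d - c) / 3 with hh
  have h0 : 0 < h := by positivity
  obtain ⟨C, hC, hsub⟩ := exists_sublevel_point (α := c + h) (β := d - h) hA hp hc
    (by linarith) (by linarith) (by linarith) hd hpos
  refine ⟨C, hC, fun μ hμ ↦ ?_⟩
  have hμ0 : 0 < μ := by linarith
  set q := Real.sinh (μ * h) with hq
  have hq0 : 0 < q := Real.sinh_pos_iff.2 (by positivity)
  set P := Real.sinh (μ * (d - c)) with hP
  set Q := μ * Real.cosh (μ * (d - c)) with hQ
  have hP0 : 0 ≤ P := Real.sinh_nonneg_iff.2 (mul_nonneg hμ0.le (by linarith))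
  have hQ0 : 0 ≤ Q := mul_nonneg hμ0.le (Real.cosh_pos _).le
  refine ⟨C * (P + Q) / q, fun M hM w v htr hw ↦ ?_⟩
  have hf := truncPow_nonneg hp (hC.trans_le hM)
  have hA0 := nonneg_on_Icc_of_pos_on_Ioo hA hcd hpos
  have hwc := hw c (left_mem_Icc.2 hcd.le)
  have hwd := hw d (right_mem_Icc.2 hcd.le)
  obtain ⟨y, hy, hyC⟩ := hsub M hM μ hμ w v htr
  have hycd : y ∈ Icc c d := ⟨by linarith [hy.1], by linarith [hy.2]⟩
  have hwy := hw y hycd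
  have hq1 : q ≤ Real.sinh (μ * (y - c)) := Real.sinh_le_sinh.2 (by gcongr; linarith [hy.1])
  have hq2 : q ≤ Real.sinh (μ * (d - y)) := Real.sinh_le_sinh.2 (by gcongr; linarith [hy.2])
  refine ⟨fun x hx ↦ ?_, y, hycd, ?_⟩
  · rw [le_div_iff₀ hq0]
    have hwx := hw x hx
    rcases le_total y x with hyx | hxy
    · have h3 := htr.mul_sinh_le hμ0 hf hc hd hA0 hwc (y := y) (x := x) (by linarith [hy.1]) hyx hx.2
      have h4 : Real.sinh (μ * (x - c)) ≤ P := Real.sinh_le_sinh.2 (by gcongr; exact hx.2)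
      have h5 : 0 ≤ Real.sinh (μ * (x - c)) :=
        Real.sinh_nonneg_iff.2 (mul_nonneg hμ0.le (by linarith [hx.1]))
      calc w x * q ≤ w x * Real.sinh (μ * (y - c)) := by gcongr
        _ ≤ w y * Real.sinh (μ * (x - c)) := h3
        _ ≤ C * P := by gcongr
        _ ≤ C * (P + Q) := by gcongr; linarith
    · have h3 := htr.mul_sinh_le' hμ0 hf hc hd hA0 hwd (y := y) (x := x) (by linarith [hy.2]) hxy hx.1
      have h4 : Real.sinh (μ * (d - x)) ≤ P := Real.sinh_le_sinh.2 (by gcongr; exact hx.1)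
      have h5 : 0 ≤ Real.sinh (μ * (d - x)) :=
        Real.sinh_nonneg_iff.2 (mul_nonneg hμ0.le (by linarith [hx.2]))
      calc w x * q ≤ w x * Real.sinh (μ * (d - y)) := by gcongr
        _ ≤ w y * Real.sinh (μ * (d - x)) := h3
        _ ≤ C * P := by gcongr
        _ ≤ C * (P + Q) := by gcongr; linarith
  · have hcosh : ∀ z, 0 ≤ z → z ≤ d - c → μ * Real.cosh (μ * z) ≤ Q := fun z hz hzd ↦ by
      rw [hQ]
      refine mul_le_mul_of_nonneg_left (Real.cosh_le_cosh.2 ?_) hμ0.le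
      rw [abs_of_nonneg (by positivity), abs_of_nonneg (mul_nonneg hμ0.le (hz.trans hzd))]
      gcongr
    have h1 := htr.wronskian_sinh_nonpos hμ0 hf hc hd hA0 hwc y hycd
    have h2 := htr.wronskian_sinh_nonpos' hμ0 hf hc hd hA0 hwd y hycd
    have h3 : w y * (μ * Real.cosh (μ * (y - c))) ≤ C * (P + Q) :=
      mul_le_mul hyC ((hcosh _ (by linarith [hycd.1]) (by linarith [hycd.2])).trans (by linarith))
        (mul_nonneg hμ0.le (Real.cosh_pos _).le) hC.le
    have h4 : w y * (μ * Real.cosh (μ * (d - y))) ≤ C * (P + Q) :=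
      mul_le_mul hyC ((hcosh _ (by linarith [hycd.2]) (by linarith [hycd.1])).trans (by linarith))
        (mul_nonneg hμ0.le (Real.cosh_pos _).le) hC.le
    rw [le_div_iff₀ hq0]
    rcases le_total 0 (v y) with hv | hv
    · rw [abs_of_nonneg hv]
      exact (mul_le_mul_of_nonneg_left hq1 hv).trans (h1.trans h3)
    · rw [abs_of_nonpos hv]
      exact (mul_le_mul_of_nonneg_left hq2 (neg_nonneg.2 hv)).trans (h2.trans h4)

end Bounds

/-- The standing assumptions of the shooting argument: `[0, T]` is divided by the nodes
`τ 0 ≤ σ 1 < τ 1 < ⋯ < τ n ≤ σ (n + 1)`, the weight is nonpositive on the gaps `[τ i, σ (i + 1)]`,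
and trajectories cannot be too large at the ends of the intervals `[σ i, τ i]`. -/
structure ShootingData (n : ℕ) (T μ κ K S : ℝ) (σ τ : ℕ → ℝ) (A f : ℝ → ℝ) : Prop where
  one_le : 1 ≤ n
  τ_zero : τ 0 = 0
  σ_last : σ (n + 1) = T
  σ_lt_τ : ∀ i, 1 ≤ i → i ≤ n → σ i < τ i
  τ_le_σ : ∀ i ≤ n, τ i ≤ σ (i + 1)
  τ_lt_σ : ∀ i, 1 ≤ i → i < n → τ i < σ (i + 1)
  σ_nonneg : ∀ i, 1 ≤ i → i ≤ n → 0 ≤ σ i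
  τ_le : ∀ i ≤ n, τ i ≤ T
  μ_pos : 0 < μ
  κ_pos : 0 < κ
  K_nonneg : 0 ≤ K
  S_pos : 0 < S
  continuous_weight : Continuous A
  f_of_nonpos : ∀ u ≤ 0, f u = 0
  f_nonneg : ∀ u, 0 ≤ f u
  lipschitz : ∀ x u u', |μ ^ 2 * (u - A x * f u) - μ ^ 2 * (u' - A x * f u')| ≤ K * |u - u'|
  small : ∀ x ∈ Icc 0 T, ∀ u, 0 < u → u ≤ κ → A x * f u < u
  weight_nonpos : ∀ i ≤ n, τ i < σ (i + 1) → ∀ x ∈ Icc (τ i) (σ (i + 1)), A x ≤ 0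
  right_lt : ∀ i, 1 ≤ i → i < n → ∀ w v, IsTrajectory T μ A f w v →
    (∀ x ∈ Icc (σ i) (τ i), 0 ≤ w x) → w (τ i) < κ * Real.cosh (μ * (σ (i + 1) - τ i))
  left_lt : ∀ i, 1 ≤ i → i < n → ∀ w v, IsTrajectory T μ A f w v →
    (∀ x ∈ Icc (σ (i + 1)) (τ (i + 1)), 0 ≤ w x) →
    w (σ (i + 1)) < κ * Real.cosh (μ * (σ (i + 1) - τ i))
  slope_lt : ∀ w v, IsTrajectory T μ A f w v → w 0 = 0 → (∀ x ∈ Icc (σ 1) (τ 1), 0 ≤ w x) → v 0 < S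

namespace ShootingData

variable {n : ℕ} {T μ κ K S : ℝ} {σ τ : ℕ → ℝ} {A f w v : ℝ → ℝ}

lemma τ_pos (h : ShootingData n T μ κ K S σ τ A f) {i : ℕ} (hi : 1 ≤ i) (hin : i ≤ n) : 0 < τ i :=
  (h.σ_nonneg i hi hin).trans_lt (h.σ_lt_τ i hi hin)

lemma T_pos (h : ShootingData n T μ κ K S σ τ A f) : 0 < T :=
  (h.τ_pos le_rfl h.one_le).trans_le (h.τ_le 1 h.one_le)

lemma linear_growth (h : ShootingData n T μ κ K S σ τ A f) :
    ∀ x ∈ Icc 0 T, ∀ u, |μ ^ 2 * (u - A x * f u)| ≤ K * |u| := by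
  intro x _ u
  simpa [h.f_of_nonpos 0 le_rfl] using h.lipschitz x u 0

lemma nonneg_of_nonneg (h : ShootingData n T μ κ K S σ τ A f) (hw : IsTrajectory T μ A f w v)
    (h0 : w 0 = 0) {i : ℕ} (hi : 1 ≤ i) (hin : i ≤ n) {x : ℝ} (hx : x ∈ Icc 0 T) (hτx : τ i ≤ x)
    (hwx : 0 ≤ w x) : ∀ y ∈ Icc (σ i) (τ i), 0 ≤ w y := fun y hy ↦
  hw.nonneg_of_nonneg h.μ_pos h.f_of_nonpos h0 hx hwx y
    ⟨(h.σ_nonneg i hi hin).trans hy.1, hy.2.trans hτx⟩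

/-- A trajectory whose maximum over `[σ i, τ i]` is `κ` attains it at `τ i`. -/
lemma eq_and_deriv_nonneg (h : ShootingData n T μ κ K S σ τ A f) (hw : IsTrajectory T μ A f w v)
    (h0 : w 0 = 0) {i : ℕ} (hi : 1 ≤ i) (hin : i ≤ n) (hle : ∀ x ∈ Icc (σ i) (τ i), w x ≤ κ)
    (hex : ∃ x ∈ Icc (σ i) (τ i), w x = κ) : w (τ i) = κ ∧ 0 ≤ v (τ i) := by
  have hκ := h.κ_pos
  have hστ := h.σ_lt_τ i hi hin
  have hσ0 := h.σ_nonneg i hi hin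
  have hτT := h.τ_le i hin
  refine hw.eq_and_deriv_nonneg_of_max h.μ_pos hσ0 hστ hτT
    (fun x hx ↦ h.small x hx κ hκ le_rfl) hle hex fun heq ↦ ?_
  have hσT : σ i ∈ Icc 0 T := ⟨hσ0, hστ.le.trans hτT⟩
  have hv : v (σ i) ≤ 0 := deriv_nonpos_of_le_left_endpoint hστ (hw _ hσT).1
    fun x hx ↦ (hle x hx).trans heq.ge
  obtain ⟨j, rfl⟩ := Nat.exists_eq_add_of_le' hi
  have hj : j = 0 ∨ 1 ≤ j := by omega
  rcases (h.τ_le_σ j (by omega)).eq_or_lt with he | hlt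
  · rcases hj with rfl | hj
    · rw [← he, h.τ_zero, h0] at heq
      exact hκ.ne heq
    · exact (h.τ_lt_σ j hj (by omega)).ne he
  · have hτ0 : 0 ≤ τ j := by
      rcases hj with rfl | hj
      · exact h.τ_zero.ge
      · exact (h.τ_pos hj (by omega)).le
    have hge := hw.cosh_le' h.μ_pos h.f_nonneg hτ0 hσT.2 (h.weight_nonpos j (by omega) hlt) hv (τ j)
      (left_mem_Icc.2 hlt.le)
    rw [heq] at hge
    rcases hj with rfl | hj
    · rw [h.τ_zero, h0] at hge
      have := mul_pos hκ (Real.cosh_pos (μ * (σ (0 + 1) - 0)))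
      linarith
    · exact hge.not_gt (h.right_lt j hj (by omega) w v hw
        (h.nonneg_of_nonneg hw h0 hj (by omega) hσT hlt.le (heq ▸ hκ.le)))

/-- A trajectory leaving `[σ i, τ i]` at the level `κ` jumps over `[σ (i + 1), τ (i + 1)]`. -/
lemma lt_and_neg_of_eq (h : ShootingData n T μ κ K S σ τ A f) (hw : IsTrajectory T μ A f w v)
    (h0 : w 0 = 0) {i : ℕ} (hi : 1 ≤ i) (hin : i < n) (heq : w (τ i) = κ) (hv : 0 ≤ v (τ i)) :
    κ < w (σ (i + 1)) ∧ w (τ (i + 1)) < 0 := by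
  have hlt := h.τ_lt_σ i hi hin
  have hστ := h.σ_lt_τ (i + 1) (by omega) hin
  have hτT := h.τ_le (i + 1) hin
  have hτ0 := h.τ_pos hi hin.le
  have hge := hw.cosh_le h.μ_pos h.f_nonneg hτ0.le (hστ.le.trans hτT)
    (h.weight_nonpos i hin.le hlt) hv _ (right_mem_Icc.2 hlt.le)
  rw [heq] at hge
  constructor
  · have h1 : 1 < Real.cosh (μ * (σ (i + 1) - τ i)) :=
      Real.one_lt_cosh.2 (mul_pos h.μ_pos (by linarith)).ne'
    exact (lt_mul_of_one_lt_right h.κ_pos h1).trans_le hge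
  · by_contra! hnn
    exact hge.not_gt (h.left_lt i hi hin w v hw (h.nonneg_of_nonneg hw h0 (by omega) hin
      ⟨by linarith, hτT⟩ le_rfl hnn))

lemma last_pos_of_eq (h : ShootingData n T μ κ K S σ τ A f) (hw : IsTrajectory T μ A f w v)
    (heq : w (τ n) = κ) (hv : 0 ≤ v (τ n)) : 0 < w T := by
  have hκ := h.κ_pos
  have hσ := h.σ_last
  rcases (h.τ_le_σ n le_rfl).eq_or_lt with he | hlt
  · rw [← hσ, ← he, heq]
    exact hκ
  · have hge := hw.cosh_le h.μ_pos h.f_nonneg (h.τ_pos h.one_le le_rfl).le hσ.le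
      (h.weight_nonpos n le_rfl hlt) hv _ (right_mem_Icc.2 hlt.le)
    rw [hσ, heq] at hge
    exact (mul_pos hκ (Real.cosh_pos _)).trans_le hge

lemma lt_of_ge (h : ShootingData n T μ κ K S σ τ A f) (hw : IsTrajectory T μ A f w v)
    (h0 : w 0 = 0) (hT : w T = 0) {i : ℕ} (hi : 1 ≤ i) (hin : i ≤ n)
    (hex : ∃ x ∈ Icc (σ i) (τ i), κ ≤ w x) : ∃ x ∈ Icc (σ i) (τ i), κ < w x := by
  by_contra! hle
  obtain ⟨x, hx, hxκ⟩ := hex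
  obtain ⟨heq, hv⟩ := h.eq_and_deriv_nonneg hw h0 hi hin hle ⟨x, hx, (hle x hx).antisymm hxκ⟩
  rcases hin.eq_or_lt with rfl | hin
  · exact (h.last_pos_of_eq hw heq hv).ne' hT
  · refine (h.lt_and_neg_of_eq hw h0 hi hin heq hv).2.not_ge ?_
    exact hw.nonneg_of_nonneg h.μ_pos h.f_of_nonpos h0 (right_mem_Icc.2 h.T_pos.le) hT.ge _
      ⟨(h.τ_pos (by omega) hin).le, h.τ_le _ hin⟩

/-- A trajectory of large initial slope crosses `[σ 1, τ 1]`. -/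
lemma crosses_first (h : ShootingData n T μ κ K S σ τ A f) (hw : IsTrajectory T μ A f w v)
    (h0 : w 0 = 0) (hv : v 0 = S) : w (τ 1) < 0 ∧ ∃ x ∈ Icc (σ 1) (τ 1), κ < w x := by
  have hμ := h.μ_pos
  have hτ1 := h.τ_pos le_rfl h.one_le
  have hτT := h.τ_le 1 h.one_le
  have hneg : w (τ 1) < 0 := by
    by_contra! hnn
    exact (h.slope_lt w v hw h0 (h.nonneg_of_nonneg hw h0 le_rfl h.one_le
      ⟨hτ1.le, hτT⟩ le_rfl hnn)).ne hv
  refine ⟨hneg, ?_⟩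
  obtain ⟨y, hy, hymax⟩ := isCompact_Icc.exists_isMaxOn (nonempty_Icc.2 hτ1.le)
    (hw.continuousOn.mono (Icc_subset_Icc_right hτT))
  have hypos : 0 < w y := by
    by_contra! hle
    have := deriv_nonpos_of_le_left_endpoint hτ1 (hw 0 (left_mem_Icc.2 h.T_pos.le)).1
      fun x hx ↦ by rw [h0]; exact (hymax hx).trans hle
    linarith [h.S_pos]
  have hy0 : 0 < y := lt_of_le_of_ne hy.1 (by rintro rfl; linarith)
  have hyτ : y < τ 1 := lt_of_le_of_ne hy.2 (by rintro rfl; linarith)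
  have hyT : y ∈ Ioo 0 T := ⟨hy0, hyτ.trans_le hτT⟩
  have hle := hw.le_of_isLocalMax hμ hyT (hymax.isLocalMax (Icc_mem_nhds hy0 hyτ))
  have hσy : σ 1 ≤ y := by
    by_contra! hlt
    have hA := h.weight_nonpos 0 (by omega) (by rw [h.τ_zero]; exact hy0.trans hlt) y
      ⟨by rw [h.τ_zero]; exact hy0.le, hlt.le⟩
    nlinarith [h.f_nonneg (w y)]
  refine ⟨y, ⟨hσy, hyτ.le⟩, ?_⟩
  by_contra! hyκ
  exact hle.not_gt (h.small y ⟨hyT.1.le, hyT.2.le⟩ _ hypos hyκ)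

lemma exists_path (h : ShootingData n T μ κ K S σ τ A f) {W V : ℝ → ℝ → ℝ} (hWc : Continuous ↿W)
    (hWV : ∀ s, IsTrajectory T μ A f (W s) (V s)) (hW0 : ∀ s, W s 0 = 0)
    (hV0 : ∀ s ∈ Icc 0 S, V s 0 = s) (E : Set ℕ) (i : ℕ) (hi : 1 ≤ i) : i ≤ n →
    ∃ θ : ℝ → ℝ, Continuous θ ∧ W (θ 0) (τ i) = 0 ∧ W (θ 1) (τ i) = κ ∧ 0 ≤ V (θ 1) (τ i) ∧
      ∀ t ∈ Icc (0 : ℝ) 1, ∀ j, 1 ≤ j → j ≤ i →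
        (j ∈ E → ∃ x ∈ Icc (σ j) (τ j), κ ≤ W (θ t) x) ∧
        (j ∉ E → ∀ x ∈ Icc (σ j) (τ j), W (θ t) x ≤ κ) := by
  have hlin := h.linear_growth
  induction i, hi using Nat.le_induction with
  | base =>
    intro hn
    have hτ := h.τ_le 1 hn
    have hσ0 := h.σ_nonneg 1 le_rfl hn
    have hend := h.crosses_first (hWV (1 * S)) (hW0 _)
      (by rw [one_mul]; exact hV0 S (right_mem_Icc.2 h.S_pos.le))
    obtain ⟨φ, hφ, -, h0, h1, h1', hlab⟩ := exists_subpaths (W := W) (V := V)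
      (θ := fun t ↦ t * S) hWc (by fun_prop) (h.σ_lt_τ 1 le_rfl hn).le h.κ_pos
      (fun x hx ↦ ((hWV (0 * S)).eq_zero_of_eq_zero h.K_nonneg hlin (left_mem_Icc.2 h.T_pos.le)
        ⟨hσ0.trans hx.1, hx.2.trans hτ⟩ (hW0 _)
        (by rw [zero_mul]; exact hV0 0 (left_mem_Icc.2 h.S_pos.le))).le)
      hend.1 hend.2 (fun t _ hle hex ↦ h.eq_and_deriv_nonneg (hWV _) (hW0 _) le_rfl hn hle hex)
      (1 ∈ E)
    refine ⟨fun t ↦ φ t * S, by fun_prop, h0, h1, h1', fun t ht j hj hj' ↦ ?_⟩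
    obtain rfl : j = 1 := le_antisymm hj' hj
    exact (hlab t ht).2
  | succ i hi ih =>
    intro hn
    obtain ⟨θ, hθ, hθ0, hθ1, hθ1', hθlab⟩ := ih (by omega)
    have hτ := h.τ_le (i + 1) hn
    have hend := h.lt_and_neg_of_eq (hWV (θ 1)) (hW0 _) hi hn hθ1 hθ1'
    have hστ := h.σ_lt_τ (i + 1) (by omega) hn
    obtain ⟨φ, hφ, hφI, h0, h1, h1', hlab⟩ := exists_subpaths (W := W) (V := V)
      (θ := θ) hWc hθ hστ.le h.κ_pos
      (fun x hx ↦ (hWV (θ 0)).nonpos_of_eq_zero h.μ_pos h.K_nonneg hlin h.f_of_nonpos (hW0 _)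
        (h.τ_pos hi (by omega)) hθ0 x ⟨(h.τ_le_σ i (by omega)).trans hx.1, hx.2.trans hτ⟩)
      hend.2 ⟨_, left_mem_Icc.2 hστ.le, hend.1⟩
      (fun t _ hle hex ↦ h.eq_and_deriv_nonneg (hWV _) (hW0 _) (by omega) hn hle hex)
      (i + 1 ∈ E)
    refine ⟨fun t ↦ θ (φ t), by fun_prop, h0, h1, h1', fun t ht j hj hj' ↦ ?_⟩
    rcases hj'.eq_or_lt with rfl | hj'
    · exact (hlab t ht).2
    · exact hθlab _ (hφI t ht) j hj (by omega)

/-- For every set of labels there is a solution exceeding `κ` exactly on the labelled intervals. -/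
lemma exists_labelled (h : ShootingData n T μ κ K S σ τ A f) (E : Set ℕ) :
    ∃ w v, IsTrajectory T μ A f w v ∧ w 0 = 0 ∧ w T = 0 ∧ (∀ x ∈ Icc 0 T, 0 ≤ w x) ∧
      ∀ i, 1 ≤ i → i ≤ n → (i ∈ E → ∃ x ∈ Icc (σ i) (τ i), κ < w x) ∧
        (i ∉ E → ∀ x ∈ Icc (σ i) (τ i), w x ≤ κ) := by
  obtain ⟨W, V, hWc, hWV, hW0, hV0⟩ := exists_family_of_trajectories h.T_pos h.S_pos.le
    h.continuous_weight h.K_nonneg (h.f_of_nonpos 0 le_rfl) h.lipschitz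
  obtain ⟨θ, hθ, hθ0, hθ1, hθ1', hlab⟩ := h.exists_path hWc hWV hW0 hV0 E n h.one_le le_rfl
  have hT : T ∈ Icc 0 T := right_mem_Icc.2 h.T_pos.le
  have hg : Continuous fun t ↦ W (θ t) T := hWc.comp (Continuous.prodMk hθ continuous_const)
  obtain ⟨t, ht, htT⟩ := intermediate_value_Icc zero_le_one hg.continuousOn
    ⟨(hWV (θ 0)).nonpos_of_eq_zero h.μ_pos h.K_nonneg h.linear_growth h.f_of_nonpos (hW0 _)
      (h.τ_pos h.one_le le_rfl) hθ0 T ⟨h.τ_le n le_rfl, le_rfl⟩,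
    (h.last_pos_of_eq (hWV (θ 1)) hθ1 hθ1').le⟩
  exact ⟨W (θ t), V (θ t), hWV _, hW0 _, htT,
    (hWV (θ t)).nonneg_of_nonneg h.μ_pos h.f_of_nonpos (hW0 _) hT htT.ge, fun i hi hin ↦
    ⟨fun hE ↦ h.lt_of_ge (hWV _) (hW0 _) htT hi hin ((hlab t ht i hi hin).1 hE),
      (hlab t ht i hi hin).2⟩⟩

end ShootingData

section Nodes

variable {n : ℕ} {σ τ : ℕ → ℝ}

lemma node_mono (hστ : ∀ i, 1 ≤ i → i ≤ n → σ i < τ i) (hτσ : ∀ i ≤ n, τ i ≤ σ (i + 1)) {i j : ℕ}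
    (hij : i ≤ j) : j ≤ n → τ i ≤ τ j := by
  induction j, hij using Nat.le_induction with
  | base => exact fun _ ↦ le_rfl
  | succ j _ ih =>
    intro hj
    exact (ih (by omega)).trans ((hτσ j (by omega)).trans (hστ (j + 1) (by omega) hj).le)

lemma exists_mem_of_nodes {y : ℝ} (hy : τ 0 < y) (m : ℕ) :
    m ≤ n → y ≤ σ (m + 1) → (∃ i, 1 ≤ i ∧ i ≤ n ∧ y ∈ Icc (σ i) (τ i)) ∨
      ∃ i ≤ n, τ i < σ (i + 1) ∧ y ∈ Icc (τ i) (σ (i + 1)) := by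
  induction m with
  | zero => exact fun hm hyσ ↦ Or.inr ⟨0, hm, hy.trans_le hyσ, hy.le, hyσ⟩
  | succ m ih =>
    intro hm hyσ
    rcases le_total y (σ (m + 1)) with h1 | h1
    · exact ih (by omega) h1
    rcases le_or_gt y (τ (m + 1)) with h2 | h2
    · exact Or.inl ⟨m + 1, by omega, hm, h1, h2⟩
    · exact Or.inr ⟨m + 1, hm, h2.trans_le hyσ, h2.le, hyσ⟩

end Nodes

lemma eventually_exists_shootingData {n : ℕ} {T p κ B : ℝ} {σ τ : ℕ → ℝ} {A : ℝ → ℝ} (hp : 1 < p)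
    (hn : 1 ≤ n) (hτ0 : τ 0 = 0) (hσT : σ (n + 1) = T)
    (hστ : ∀ i, 1 ≤ i → i ≤ n → σ i < τ i) (hτσ : ∀ i ≤ n, τ i ≤ σ (i + 1))
    (hτσ' : ∀ i, 1 ≤ i → i < n → τ i < σ (i + 1)) (hA : Continuous A) (hB : ∀ x, |A x| ≤ B)
    (hpos : ∀ i, 1 ≤ i → i ≤ n → ∀ x ∈ Ioo (σ i) (τ i), 0 < A x)
    (hneg : ∀ i ≤ n, ∀ x ∈ Ioo (τ i) (σ (i + 1)), A x < 0) (hκ : 0 < κ)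
    (hκB : B * κ ^ (p - 1) < 1) :
    ∀ᶠ μ in atTop, ∃ M K S, ShootingData n T μ κ K S σ τ A (truncPow p M) ∧
      ∀ w v, IsTrajectory T μ A (truncPow p M) w v → w 0 = 0 → w T = 0 →
        (∀ x ∈ Icc 0 T, 0 ≤ w x) → ∀ x ∈ Icc 0 T, w x ≤ M := by
  have hτ_nonneg : ∀ i ≤ n, 0 ≤ τ i := fun i hi ↦ hτ0 ▸ node_mono hστ hτσ (Nat.zero_le i) hi
  have hτT : ∀ i ≤ n, τ i ≤ T := fun i hi ↦
    hσT ▸ (node_mono hστ hτσ hi le_rfl).trans (hτσ n le_rfl)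
  have hσ_nonneg : ∀ i, 1 ≤ i → i ≤ n → 0 ≤ σ i := fun i hi hin ↦ by
    obtain ⟨j, rfl⟩ := Nat.exists_eq_add_of_le' hi
    exact (hτ_nonneg j (by omega)).trans (hτσ j (by omega))
  have hT : 0 < T :=
    (hσ_nonneg 1 le_rfl hn).trans_lt ((hστ 1 le_rfl hn).trans_le (hτT 1 hn))
  have hA_nonpos : ∀ i ≤ n, τ i < σ (i + 1) → ∀ x ∈ Icc (τ i) (σ (i + 1)), A x ≤ 0 := by
    intro i hi hlt x hx
    exact neg_nonneg.1 (nonneg_on_Icc_of_pos_on_Ioo hA.neg hlt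
      (fun y hy ↦ neg_pos.2 (hneg i hi y hy)) x hx)
  have hends : ∀ᶠ μ in atTop, ∀ᶠ M in atTop, ∀ i ∈ Finset.Ico 1 n, ∀ w v,
      IsTrajectory T μ A (truncPow p M) w v →
      ((∀ x ∈ Icc (σ i) (τ i), 0 ≤ w x) → w (τ i) < κ * Real.cosh (μ * (σ (i + 1) - τ i))) ∧
      ((∀ x ∈ Icc (σ (i + 1)) (τ (i + 1)), 0 ≤ w x) →
        w (σ (i + 1)) < κ * Real.cosh (μ * (σ (i + 1) - τ i))) := by
    simp_rw [Filter.eventually_all_finset]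
    intro i hi
    obtain ⟨hi, hin⟩ := Finset.mem_Ico.1 hi
    have hgap : 0 < σ (i + 1) - τ i := sub_pos.2 (hτσ' i hi hin)
    obtain ⟨C₁, -, μ₁, H₁⟩ := exists_right_endpoint_bound hA hp (hσ_nonneg i hi hin.le)
      (hστ i hi hin.le) (hτT i hin.le) (hpos i hi hin.le) hκ hgap
    obtain ⟨C₂, -, μ₂, H₂⟩ := exists_left_endpoint_bound hA hp (hσ_nonneg (i + 1) (by omega) hin)
      (hστ (i + 1) (by omega) hin) (hτT (i + 1) hin) (hpos (i + 1) (by omega) hin) hκ hgap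
    filter_upwards [eventually_ge_atTop 1, eventually_ge_atTop μ₁, eventually_ge_atTop μ₂]
      with μ h1 h2 h3
    filter_upwards [eventually_ge_atTop C₁, eventually_ge_atTop C₂] with M h4 h5 w v hw
    exact ⟨H₁ M h4 μ h1 h2 w v hw, H₂ M h5 μ h1 h3 w v hw⟩
  filter_upwards [hends, eventually_ge_atTop 1] with μ hμends hμ
  have hunif : ∀ᶠ D in atTop, ∀ᶠ M in atTop, ∀ i ∈ Finset.Icc 1 n, ∀ w v,
      IsTrajectory T μ A (truncPow p M) w v → (∀ x ∈ Icc (σ i) (τ i), 0 ≤ w x) →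
      (∀ x ∈ Icc (σ i) (τ i), w x ≤ D) ∧ ∃ y ∈ Icc (σ i) (τ i), |v y| ≤ D := by
    simp_rw [Filter.eventually_all_finset]
    intro i hi
    obtain ⟨hi, hin⟩ := Finset.mem_Icc.1 hi
    obtain ⟨C, -, H⟩ := exists_uniform_bound hA hp (hσ_nonneg i hi hin)
      (hστ i hi hin) (hτT i hin) (hpos i hi hin)
    obtain ⟨D₀, H⟩ := H μ hμ
    filter_upwards [eventually_ge_atTop D₀] with D hD
    filter_upwards [eventually_ge_atTop C] with M hM w v hw hnn
    obtain ⟨h1, y, hy, h2⟩ := H M hM w v hw hnn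
    exact ⟨fun x hx ↦ (h1 x hx).trans hD, y, hy, h2.trans hD⟩
  obtain ⟨D, hD, hD0⟩ := (hunif.and (eventually_ge_atTop 0)).exists
  obtain ⟨M, ⟨⟨hM₁, hM₂⟩, hDM⟩, hM0⟩ :=
    (((hμends.and hD).and (eventually_ge_atTop D)).and (eventually_gt_atTop 0)).exists
  obtain ⟨K, hK, hlip⟩ := exists_linear_bound (μ := μ) hB hp hM0
  have hμ0 : 0 < μ := by linarith
  set S := Real.exp ((1 + K) * T) * (2 * D ^ 2) + 1 with hS
  have hS1 : 1 ≤ S := by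
    have : 0 ≤ Real.exp ((1 + K) * T) * (2 * D ^ 2) := by positivity
    linarith
  refine ⟨M, K, S, ⟨hn, hτ0, hσT, hστ, hτσ, hτσ', hσ_nonneg, hτT, hμ0, hκ, hK, by linarith, hA,
    fun u hu ↦ truncPow_of_nonpos hp hM0 hu, truncPow_nonneg hp hM0, hlip, fun x hx u hu huκ ↦ ?_,
    hA_nonpos, fun i hi hin w v hw ↦ (hM₁ i (Finset.mem_Ico.2 ⟨hi, hin⟩) w v hw).1,
    fun i hi hin w v hw ↦ (hM₁ i (Finset.mem_Ico.2 ⟨hi, hin⟩) w v hw).2,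
    fun w v hw h0 hnn ↦ ?_⟩, fun w v hw h0 hwT hnn ↦ ?_⟩
  · have hB0 : 0 ≤ B := (abs_nonneg _).trans (hB 0)
    calc A x * truncPow p M u ≤ B * (κ ^ (p - 1) * u) :=
          mul_le_mul ((le_abs_self _).trans (hB x)) (truncPow_le hp hM0 hu.le huκ)
            (truncPow_nonneg hp hM0 u) hB0
      _ = (B * κ ^ (p - 1)) * u := by ring
      _ < 1 * u := mul_lt_mul_of_pos_right hκB hu
      _ = u := one_mul u
  · obtain ⟨hle, y, hy, hvy⟩ := hM₂ 1 (Finset.mem_Icc.2 ⟨le_rfl, hn⟩) w v hw hnn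
    have hlin : ∀ x ∈ Icc 0 T, ∀ u, |μ ^ 2 * (u - A x * truncPow p M u)| ≤ K * |u| := by
      intro x _ u
      simpa [truncPow_of_nonpos hp hM0 le_rfl] using hlip x u 0
    have h1 := hw.sq_add_sq_le hK hlin (x := y) (y := 0)
      ⟨(hσ_nonneg 1 le_rfl hn).trans hy.1, hy.2.trans (hτT 1 hn)⟩ (left_mem_Icc.2 hT.le)
    have h2 : w y ^ 2 ≤ D ^ 2 := pow_le_pow_left₀ (hnn y hy) (hle y hy) 2
    have h3 : v y ^ 2 ≤ D ^ 2 := sq_le_sq.2 (by rwa [abs_of_nonneg hD0])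
    have h4 : Real.exp ((1 + K) * T) * (w y ^ 2 + v y ^ 2) ≤
        Real.exp ((1 + K) * T) * (2 * D ^ 2) := by gcongr; linarith
    rw [h0] at h1
    nlinarith [sq_nonneg (v 0)]
  · obtain ⟨y, hy, hymax⟩ := isCompact_Icc.exists_isMaxOn (nonempty_Icc.2 hT.le) hw.continuousOn
    refine fun x hx ↦ (hymax hx).trans ?_
    rcases (hnn y hy).eq_or_lt with hwy | hwy
    · exact hwy ▸ hM0.le
    have hy0 : 0 < y := lt_of_le_of_ne hy.1 (by rintro rfl; linarith)
    have hyT : y < T := lt_of_le_of_ne hy.2 (by rintro rfl; linarith)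
    have hAy := hw.le_of_isLocalMax hμ0 ⟨hy0, hyT⟩ (hymax.isLocalMax (Icc_mem_nhds hy0 hyT))
    rcases exists_mem_of_nodes (hτ0 ▸ hy0) n le_rfl (hσT ▸ hyT.le) with
      ⟨i, hi, hin, hyi⟩ | ⟨i, hin, hlt, hyi⟩
    · refine ((hM₂ i (Finset.mem_Icc.2 ⟨hi, hin⟩) w v hw fun z hz ↦ hnn z ?_).1 y hyi).trans hDM
      exact ⟨(hσ_nonneg i hi hin).trans hz.1, hz.2.trans (hτT i hin)⟩
    · nlinarith [hA_nonpos i hin hlt y hyi, truncPow_nonneg hp hM0 (w y)]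

/-- Rescaling a trajectory that stays below the truncation level. -/
lemma IsTrajectory.isNonnegSol {L p μ M : ℝ} {a A w v : ℝ → ℝ} (hp : 1 < p) (hμ : 0 < μ)
    (hA : Continuous A) (haA : ∀ x ∈ Icc 0 L, A x = a x)
    (h : IsTrajectory L μ A (truncPow p M) w v) (h0 : w 0 = 0) (hL : w L = 0)
    (hnn : ∀ x ∈ Icc 0 L, 0 ≤ w x) (hle : ∀ x ∈ Icc 0 L, w x ≤ M) :
    IsNonnegSol L p (-μ ^ 2) a fun x ↦ μ ^ (2 / (p - 1)) * w x := by
  set k : ℝ := μ ^ (2 / (p - 1)) with hk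
  have hk0 : 0 < k := Real.rpow_pos_of_pos hμ _
  have hkp : k ^ p = k * μ ^ 2 := by
    have h1 : k ^ (p - 1) = μ ^ 2 := by
      rw [hk, ← Real.rpow_mul hμ.le, div_mul_cancel₀ _ (by linarith), Real.rpow_two]
    rw [← h1, ← Real.rpow_one_add' hk0.le (by linarith)]
    congr 1; ring
  refine ⟨fun x ↦ k * v x, fun x ↦ k * (μ ^ 2 * (w x - A x * w x ^ p)),
    fun x hx ↦ ((h x hx).1.const_mul k).hasDerivWithinAt, fun x hx ↦ ?_, ?_,
    fun x hx ↦ mul_nonneg hk0.le (hnn x hx), fun x hx ↦ ?_, by simp [h0], by simp [hL]⟩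
  · have := ((h x hx).2.const_mul k).hasDerivWithinAt (s := Icc 0 L)
    rwa [truncPow_eq_rpow hp (hnn x hx) (hle x hx)] at this
  · have hw := h.continuousOn
    have hwp : ContinuousOn (fun x ↦ w x ^ p) (Icc 0 L) :=
      hw.rpow_const fun x _ ↦ Or.inr (by linarith)
    fun_prop
  · have hx' := Ioo_subset_Icc_self hx
    rw [Real.mul_rpow hk0.le (hnn x hx'), hkp, ← haA x hx']
    ring

/-- A family of functions indexed by sets of labels, where the labels can be read off. -/
lemma exists_finset_of_labelled {n : ℕ} {L κ : ℝ} {σ τ : ℕ → ℝ} {P : (ℝ → ℝ) → Prop}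
    (hκ : 0 < κ) (hστ : ∀ i, 1 ≤ i → i ≤ n → Icc (σ i) (τ i) ⊆ Icc 0 L)
    (H : ∀ E : Set ℕ, ∃ u, P u ∧ ∀ i, 1 ≤ i → i ≤ n →
      (i ∈ E → ∃ x ∈ Icc (σ i) (τ i), κ < u x) ∧ (i ∉ E → ∀ x ∈ Icc (σ i) (τ i), u x ≤ κ)) :
    ∃ S : Finset (ℝ → ℝ), 2 ^ n - 1 ≤ S.card ∧ (∀ u ∈ S, P u ∧ ∃ x ∈ Icc 0 L, u x ≠ 0) ∧
      ∀ u ∈ S, ∀ v ∈ S, u ≠ v → ∃ x ∈ Icc (0 : ℝ) L, u x ≠ v x := by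
  classical
  choose F hP hF using H
  set 𝓔 : Finset (Finset ℕ) := (Finset.Icc 1 n).powerset.erase ∅ with h𝓔
  have hmem : ∀ E ∈ 𝓔, E ≠ ∅ ∧ ∀ i ∈ E, 1 ≤ i ∧ i ≤ n := fun E hE ↦ by
    rw [h𝓔, Finset.mem_erase, Finset.mem_powerset] at hE
    exact ⟨hE.1, fun i hi ↦ Finset.mem_Icc.1 (hE.2 hi)⟩
  have hsep : ∀ E ∈ 𝓔, ∀ E' : Finset ℕ, ¬E ⊆ E' →
      ∃ x ∈ Icc 0 L, F (E' : Set ℕ) x < F (E : Set ℕ) x := by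
    intro E hE E' hEE'
    obtain ⟨i, hi, hi'⟩ := Finset.not_subset.1 hEE'
    obtain ⟨h1, h2⟩ := (hmem E hE).2 i hi
    obtain ⟨x, hx, hxκ⟩ := (hF E i h1 h2).1 (by simpa using hi)
    exact ⟨x, hστ i h1 h2 hx, ((hF E' i h1 h2).2 (by simpa using hi') x hx).trans_lt hxκ⟩
  have hne : ∀ E ∈ 𝓔, ∀ E' ∈ 𝓔, E ≠ E' → ∃ x ∈ Icc 0 L, F (E : Set ℕ) x ≠ F (E' : Set ℕ) x := by
    intro E hE E' hE' hEE'
    by_cases hsub : E ⊆ E'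
    · obtain ⟨x, hx, hlt⟩ := hsep E' hE' E fun h ↦ hEE' (hsub.antisymm h)
      exact ⟨x, hx, hlt.ne⟩
    · obtain ⟨x, hx, hlt⟩ := hsep E hE E' hsub
      exact ⟨x, hx, hlt.ne'⟩
  refine ⟨𝓔.image fun E : Finset ℕ ↦ F (E : Set ℕ), ?_, ?_, ?_⟩
  · rw [Finset.card_image_of_injOn, h𝓔, Finset.card_erase_of_mem (by simp), Finset.card_powerset,
      Nat.card_Icc, Nat.add_sub_cancel]
    intro E hE E' hE' heq
    by_contra hEE'
    obtain ⟨x, -, hx⟩ := hne E hE E' hE' hEE'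
    exact hx (congrFun heq x)
  · simp only [Finset.forall_mem_image]
    intro E hE
    obtain ⟨i, hi⟩ := Finset.nonempty_iff_ne_empty.2 (hmem E hE).1
    obtain ⟨h1, h2⟩ := (hmem E hE).2 i hi
    obtain ⟨x, hx, hxκ⟩ := (hF E i h1 h2).1 (by simpa using hi)
    exact ⟨hP E, x, hστ i h1 h2 hx, (hκ.trans hxκ).ne'⟩
  · simp only [Finset.forall_mem_image]
    intro E hE E' hE' huv
    exact hne E hE E' hE' fun h ↦ huv (by rw [h])

theorem multiplicity_of_positive_solutions
    (L p : ℝ) (hL : 0 < L) (hp : 1 < p)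
    (a : ℝ → ℝ) (ha : ContinuousOn a (Icc 0 L))
    (n : ℕ) (hn : 1 ≤ n) (σ τ : ℕ → ℝ)
    (hτ0 : τ 0 = 0) (hσlast : σ (n + 1) = L)
    (h0σ : τ 0 ≤ σ 1) (hτL : τ n ≤ σ (n + 1))
    (hστ : ∀ i, 1 ≤ i → i ≤ n → σ i < τ i)
    (hτσ : ∀ i, 1 ≤ i → i < n → τ i < σ (i + 1))
    (hapos : ∀ i, 1 ≤ i → i ≤ n → ∀ x ∈ Ioo (σ i) (τ i), 0 < a x)
    (haneg : ∀ i, i ≤ n → ∀ x ∈ Ioo (τ i) (σ (i + 1)), a x < 0)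
    (γ : ℕ → ℝ) (hγ : ∀ i, 1 ≤ i → i ≤ n → 0 < γ i)
    (hG : ∀ i, 1 ≤ i → i ≤ n → ∃ ρi : ℝ → ℝ,
      ContinuousOn ρi (Icc (σ i) (τ i)) ∧
      (∃ ε > (0:ℝ), ∃ c > (0:ℝ), ∀ x ∈ Icc (σ i) (τ i),
        (|x - σ i| < ε ∨ |x - τ i| < ε) → c ≤ |ρi x|) ∧
      (∀ x ∈ Ioo (σ i) (τ i), a x = ρi x * (min (x - σ i) (τ i - x)) ^ γ i)) :
    ∃ lc < (0:ℝ), ∀ lam < lc,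
      ∃ S : Finset (ℝ → ℝ), 2 ^ n - 1 ≤ S.card ∧
        (∀ u ∈ S, IsNonnegSol L p lam a u ∧ ∃ x ∈ Icc 0 L, u x ≠ 0) ∧
        (∀ u ∈ S, ∀ v ∈ S, u ≠ v → ∃ x ∈ Icc (0:ℝ) L, u x ≠ v x) := by
  have hτσ' : ∀ i ≤ n, τ i ≤ σ (i + 1) := fun i hi ↦ by
    rcases Nat.eq_zero_or_pos i with rfl | hi0
    · exact h0σ
    · rcases hi.eq_or_lt with rfl | hin
      · exact hτL
      · exact (hτσ i hi0 hin).le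
  set A : ℝ → ℝ := IccExtend hL.le ((Icc 0 L).domRestrict a)
  have hA : Continuous A := ha.domRestrict.Icc_extend'
  have haA : ∀ x ∈ Icc 0 L, A x = a x := fun x hx ↦ IccExtend_of_mem hL.le _ hx
  obtain ⟨B, hB⟩ : ∃ B, ∀ x, |A x| ≤ B := by
    obtain ⟨B, hB⟩ := isCompact_Icc.exists_bound_of_continuousOn ha
    exact ⟨B, fun x ↦ hB _ (projIcc 0 L hL.le x).2⟩
  have hB0 : 0 ≤ B := (abs_nonneg _).trans (hB 0)
  set κ : ℝ := (1 / (B + 1)) ^ (p - 1)⁻¹ with hκdef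
  have hκ : 0 < κ := Real.rpow_pos_of_pos (by positivity) _
  have hκB : B * κ ^ (p - 1) < 1 := by
    rw [hκdef, Real.rpow_inv_rpow (by positivity) (by linarith), mul_one_div,
      div_lt_one (by positivity)]
    linarith
  have hsub : ∀ i, 1 ≤ i → i ≤ n → Icc (σ i) (τ i) ⊆ Icc 0 L := fun i hi hin ↦ by
    refine Icc_subset_Icc ?_ (hσlast ▸ (node_mono hστ hτσ' hin le_rfl).trans hτL)
    obtain ⟨j, rfl⟩ := Nat.exists_eq_add_of_le' hi
    exact hτ0 ▸ (node_mono hστ hτσ' (Nat.zero_le j) (by omega)).trans (hτσ' j (by omega))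
  have hsub' : ∀ i ≤ n, Icc (τ i) (σ (i + 1)) ⊆ Icc 0 L := fun i hi ↦ by
    refine Icc_subset_Icc (hτ0 ▸ node_mono hστ hτσ' (Nat.zero_le i) hi) ?_
    rcases hi.eq_or_lt with rfl | hin
    · exact hσlast.le
    · exact (hsub (i + 1) (by omega) hin (left_mem_Icc.2 (hστ (i + 1) (by omega) hin).le)).2
  obtain ⟨μ₀, hμ₀⟩ := eventually_atTop.1 (eventually_exists_shootingData hp hn hτ0 hσlast hστ hτσ'
    hτσ hA hB
    (fun i hi hin x hx ↦ haA x (hsub i hi hin (Ioo_subset_Icc_self hx)) ▸ hapos i hi hin x hx)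
    (fun i hin x hx ↦ haA x (hsub' i hin (Ioo_subset_Icc_self hx)) ▸ haneg i hin x hx) hκ hκB)
  refine ⟨-(max 1 μ₀) ^ 2, neg_lt_zero.2 (by positivity), fun lam hlam ↦ ?_⟩
  set μ := √(-lam) with hμdef
  have hμsq : μ ^ 2 = -lam := Real.sq_sqrt (by nlinarith [sq_nonneg (max 1 μ₀)])
  have hμmax : max 1 μ₀ ≤ μ := Real.le_sqrt_of_sq_le (by linarith)
  have hμ : 0 < μ := zero_lt_one.trans_le ((le_max_left _ _).trans hμmax)
  obtain ⟨M, K, S, hdata, hM⟩ := hμ₀ μ ((le_max_right _ _).trans hμmax)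
  have hk : 0 < μ ^ (2 / (p - 1)) := Real.rpow_pos_of_pos hμ _
  refine exists_finset_of_labelled (mul_pos hk hκ) hsub fun E ↦ ?_
  obtain ⟨w, v, hw, h0, hwL, hnn, hlab⟩ := hdata.exists_labelled E
  refine ⟨fun x ↦ μ ^ (2 / (p - 1)) * w x, ?_, fun i hi hin ↦ ⟨fun hE ↦ ?_, fun hE x hx ↦ ?_⟩⟩
  · have := hw.isNonnegSol hp hμ hA haA h0 hwL hnn (hM w v hw h0 hwL hnn)
    rwa [hμsq, neg_neg] at this
  · obtain ⟨x, hx, hxκ⟩ := (hlab i hi hin).1 hE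
    exact ⟨x, hx, mul_lt_mul_of_pos_left hxκ hk⟩
  · exact mul_le_mul_of_nonneg_left ((hlab i hi hin).2 hE x hx) hk.le
end

section
/- Assume hypothesis (Ha) and let λ < 0. Set r_λ := (−λ / ‖a‖_{L^∞([0,L])})^{1/(p−1)}. Then for every ϑ ∈ (0,1], every function u ∈ C²([0,L]) with u ≥ 0, u not identically zero, u(0) = u(L) = 0, and −u''(x) = ϑ (λ u(x) + a(x) u(x)^p) for all x ∈ (0,L), satisfies ‖u‖_{L^∞([0,L])} ≥ r_λ. -/
open Set

/-- The `L^∞`-norm of a function on a set: `sup` of `|v|`. -/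
noncomputable def supNorm (v : ℝ → ℝ) (K : Set ℝ) : ℝ :=
  sSup ((fun x => |v x|) '' K)

theorem abs_le_supNorm {v : ℝ → ℝ} {K : Set ℝ} (hK : IsCompact K) (hv : ContinuousOn v K)
    {x : ℝ} (hx : x ∈ K) : |v x| ≤ supNorm v K :=
  le_csSup (hK.image_of_continuousOn hv.abs).bddAbove ⟨x, hx, rfl⟩

theorem supNorm_nonneg (v : ℝ → ℝ) (K : Set ℝ) : 0 ≤ supNorm v K := by
  apply Real.sSup_nonneg
  rintro _ ⟨x, -, rfl⟩
  exact abs_nonneg _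

theorem mul_rpow_le_of_lt_div_rpow {A M b q : ℝ} (hA : 0 ≤ A) (hM : 0 ≤ M) (hb : 0 ≤ b)
    (hq : 0 < q) (h : M < (b / A) ^ (1 / q)) : A * M ^ q ≤ b := by
  rcases hA.eq_or_lt with rfl | hA
  · simpa using hb
  · have h' := Real.rpow_le_rpow hM h.le hq.le
    rw [← Real.rpow_mul (by positivity), one_div_mul_cancel hq.ne', Real.rpow_one,
      le_div_iff₀ hA] at h'
    linarith

theorem lower_bound_homotopy_solutions
    (L p : ℝ) (hL : 0 < L) (hp : 1 < p)
    (a : ℝ → ℝ) (ha : ContinuousOn a (Icc 0 L))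
    (n : ℕ) (hn : 1 ≤ n) (σ τ : ℕ → ℝ)
    (hτ0 : τ 0 = 0) (hσlast : σ (n + 1) = L)
    (h0σ : τ 0 ≤ σ 1) (hτL : τ n ≤ σ (n + 1))
    (hστ : ∀ i, 1 ≤ i → i ≤ n → σ i < τ i)
    (hτσ : ∀ i, 1 ≤ i → i < n → τ i < σ (i + 1))
    (hapos : ∀ i, 1 ≤ i → i ≤ n → ∀ x ∈ Ioo (σ i) (τ i), 0 < a x)
    (haneg : ∀ i, i ≤ n → ∀ x ∈ Ioo (τ i) (σ (i + 1)), a x < 0)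
    (lam : ℝ) (hlam : lam < 0)
    (ϑ : ℝ) (hϑ0 : 0 < ϑ) (hϑ1 : ϑ ≤ 1)
    (u u' u'' : ℝ → ℝ)
    (hu1 : ∀ x ∈ Icc (0:ℝ) L, HasDerivWithinAt u (u' x) (Icc (0:ℝ) L) x)
    (hu2 : ∀ x ∈ Icc (0:ℝ) L, HasDerivWithinAt u' (u'' x) (Icc (0:ℝ) L) x)
    (hu2c : ContinuousOn u'' (Icc (0:ℝ) L))
    (hunn : ∀ x ∈ Icc (0:ℝ) L, 0 ≤ u x)
    (hune : ∃ x ∈ Icc (0:ℝ) L, u x ≠ 0)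
    (hbc : u 0 = 0 ∧ u L = 0)
    (heq : ∀ x ∈ Ioo (0:ℝ) L, -u'' x = ϑ * (lam * u x + a x * u x ^ p)) :
    (-lam / supNorm a (Icc 0 L)) ^ (1 / (p - 1)) ≤ supNorm u (Icc 0 L) := by
  by_contra! hlt
  have hcu : ContinuousOn u (Icc 0 L) := fun x hx => (hu1 x hx).continuousWithinAt
  have hM := supNorm_nonneg u (Icc 0 L)
  have hAM := mul_rpow_le_of_lt_div_rpow (supNorm_nonneg a (Icc 0 L)) hM (by linarith)
    (sub_pos.2 hp) hlt
  have hconv : ConvexOn ℝ (Icc 0 L) u := by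
    refine convexOn_of_hasDerivWithinAt2_nonneg (f' := u') (f'' := u'') (convex_Icc 0 L) hcu
      (fun x hx => (hu1 x (interior_subset hx)).mono interior_subset)
      (fun x hx => (hu2 x (interior_subset hx)).mono interior_subset) fun x hx => ?_
    rw [interior_Icc] at hx
    have hxI := Ioo_subset_Icc_self hx
    have hu0 := hunn x hxI
    have huM : u x ≤ supNorm u (Icc 0 L) :=
      (le_abs_self _).trans (abs_le_supNorm isCompact_Icc hcu hxI)
    have haA : a x ≤ supNorm a (Icc 0 L) :=
      (le_abs_self _).trans (abs_le_supNorm isCompact_Icc ha hxI)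
    have hpow : u x ^ p = u x ^ (p - 1) * u x := by
      rw [← Real.rpow_add_one' hu0 (by linarith), sub_add_cancel]
    have hle : a x * u x ^ (p - 1) ≤ -lam :=
      (mul_le_mul haA (Real.rpow_le_rpow hu0 huM (by linarith)) (by positivity)
        (supNorm_nonneg _ _)).trans hAM
    have hreact : lam * u x + a x * u x ^ p ≤ 0 := by
      rw [hpow]
      nlinarith [mul_le_mul_of_nonneg_right hle hu0]
    linarith [heq x hx, mul_nonpos_of_nonneg_of_nonpos hϑ0.le hreact]
  obtain ⟨x, hx, hne⟩ := hune
  have hmax := hconv.le_max_of_mem_Icc (left_mem_Icc.2 hL.le) (right_mem_Icc.2 hL.le) hx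
  rw [hbc.1, hbc.2, max_self] at hmax
  exact hne (le_antisymm hmax (hunn x hx))
end
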